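/- arXiv:1701.04734 — 3 statements merged into one kernel-verified Lean document; each statement's English description precedes it below -/
import Mathlib

section
/- Let Δ be a pure simplicial complex on X = {x_1,…,x_n} of dimension d, K a field, and let s ≥ 1 and α = (s,s,…,s) ∈ ℕ^n. If the facet ideal I(Δ) ⊆ S = K[x_1,…,x_n] has linear quotients, then pd(I(Δ^α)) = pd(I(Δ))·s + (d+1)(s−1). -/
/-- An (abstract) simplicial complex: a collection of finite subsets of the vertex set
closed under taking subsets. -/
def IsComplex {V : Type*} (Δ : Set (Finset V)) : Prop :=
  ∀ ⦃F G : Finset V⦄, F ∈ Δ → G ⊆ F → G ∈ Δ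

/-- `F` is a facet (maximal face) of `Δ`. -/
def IsFacet {V : Type*} (Δ : Set (Finset V)) (F : Finset V) : Prop :=
  F ∈ Δ ∧ ∀ G ∈ Δ, F ⊆ G → F = G

/-- The faces of the expansion `⟨F⟩^α` of the simplex with facet `F`. -/
def simplexExpansion {V : Type*} [DecidableEq V] (F : Finset V) (α : V → ℕ) :
    Set (Finset ((v : V) × Fin (α v))) :=
  {G | G.image Sigma.fst ⊆ F ∧ Set.InjOn Sigma.fst (G : Set ((v : V) × Fin (α v)))}

/-- The expansion `Δ^α` of a simplicial complex `Δ` with respect to `α`. -/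
def expansion {V : Type*} [DecidableEq V] (Δ : Set (Finset V)) (α : V → ℕ) :
    Set (Finset ((v : V) × Fin (α v))) :=
  ⋃ F ∈ Δ, simplexExpansion F α

/-- The facet ideal `I(Δ) = (x^F : F ∈ 𝔉(Δ))` of a simplicial complex. -/
noncomputable def facetIdeal (K : Type*) [Field K] {V : Type*} (Δ : Set (Finset V)) :
    Ideal (MvPolynomial V K) :=
  Ideal.span ((fun F => ∏ v ∈ F, MvPolynomial.X v) '' {F | IsFacet Δ F})

/-- The facet ideal of `Δ` has linear quotients: there is an ordering `f_1, …, f_m` of its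
minimal monomial generators (the monomials `x^F` for the facets `F` of `Δ`) such that each
colon ideal `(f_1, …, f_{i-1}) : (f_i)` is generated by a subset of the variables. -/
def HasLinearQuotients (K : Type*) [Field K] {V : Type*} (Δ : Set (Finset V)) : Prop :=
  ∃ (m : ℕ) (f : Fin m → Finset V),
    Function.Injective f ∧ Set.range f = {F | IsFacet Δ F} ∧
    ∀ i : Fin m, 0 < i.val →
      ∃ T : Set V,
        (Ideal.span ((fun F => (∏ v ∈ F, MvPolynomial.X v : MvPolynomial V K)) ''
            {F | ∃ j : Fin m, j < i ∧ f j = F})).colon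
          (Ideal.span {(∏ v ∈ f i, MvPolynomial.X v : MvPolynomial V K)}) =
        Ideal.span (MvPolynomial.X '' T)

/-- `HasProjDimLE R n M` says that `M` admits a projective resolution of length at most `n`. -/
def HasProjDimLE (R : Type) [CommRing R] : ℕ → ∀ (M : Type) [AddCommGroup M] [Module R M], Prop
  | 0, M, _, _ => Module.Projective R M
  | n + 1, M, _, _ => ∃ (P : Type) (_ : AddCommGroup P) (_ : Module R P) (f : P →ₗ[R] M),
      Module.Projective R P ∧ Function.Surjective f ∧ HasProjDimLE R n (LinearMap.ker f)

/-- The projective dimension of a module: the length of a shortest projective resolution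
(`⊤` if there is no finite projective resolution). -/
noncomputable def projDim (R : Type) [CommRing R] (M : Type) [AddCommGroup M] [Module R M] :
    ℕ∞ :=
  sInf {n : ℕ∞ | ∃ k : ℕ, (k : ℕ∞) = n ∧ HasProjDimLE R k M}

section ExtGenerated

open CategoryTheory Abelian

universe w v u

variable {C : Type u} [Category.{v} C] [Abelian C] [HasExt.{w} C]

/-- `Ext^*(M, k)` is generated, as a right module over `Ext^*(k, k)`, by its degree zero part. -/
def ExtGenerated (k M : C) : Prop :=
  ∀ (p : ℕ) (x : Ext M k p), x ∈ AddSubgroup.closure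
    {y : Ext M k p | ∃ (φ : M ⟶ k) (w : Ext k k p), y = (Ext.mk₀ φ).comp w (zero_add p)}

lemma ExtGenerated.of_surjective {k M : C} (g : M ⟶ k)
    (hg : ∀ (p : ℕ) (x : Ext M k p), ∃ w : Ext k k p, (Ext.mk₀ g).comp w (zero_add p) = x) :
    ExtGenerated k M := fun p x => by
  obtain ⟨w, rfl⟩ := hg p x
  exact AddSubgroup.subset_closure ⟨g, w, rfl⟩

variable {k : C} {S : ShortComplex C} (hS : S.ShortExact)
  (hext : ∀ φ : S.X₁ ⟶ k, ∃ ψ : S.X₂ ⟶ k, S.f ≫ ψ = φ)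

include hext in
lemma ExtGenerated.exists_restrict_eq (h₁ : ExtGenerated k S.X₁) {p : ℕ} (x : Ext S.X₁ k p) :
    ∃ z ∈ AddSubgroup.closure {y : Ext S.X₂ k p | ∃ (φ : S.X₂ ⟶ k) (w : Ext k k p),
      y = (Ext.mk₀ φ).comp w (zero_add p)}, (Ext.mk₀ S.f).comp z (zero_add p) = x := by
  induction h₁ p x using AddSubgroup.closure_induction with
  | mem x hx =>
    obtain ⟨φ, w, rfl⟩ := hx
    obtain ⟨ψ, rfl⟩ := hext φ
    exact ⟨_, AddSubgroup.subset_closure ⟨ψ, w, rfl⟩, by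
      rw [Ext.mk₀_comp_mk₀_assoc]⟩
  | zero => exact ⟨0, zero_mem _, Ext.comp_zero _ _ _ _ _⟩
  | add x y _ _ hx hy =>
    obtain ⟨a, ha, rfl⟩ := hx
    obtain ⟨b, hb, rfl⟩ := hy
    exact ⟨a + b, add_mem ha hb, Ext.comp_add _ _ _ _⟩
  | neg x _ hx =>
    obtain ⟨a, ha, rfl⟩ := hx
    exact ⟨-a, neg_mem ha, Ext.comp_neg _ _ _⟩

include hS hext in
lemma ExtGenerated.extension (h₁ : ExtGenerated k S.X₁) (h₃ : ExtGenerated k S.X₃) :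
    ExtGenerated k S.X₂ := fun p x => by
  obtain ⟨z, hz, hzx⟩ := h₁.exists_restrict_eq hext ((Ext.mk₀ S.f).comp x (zero_add p))
  obtain ⟨u, hu⟩ := Ext.contravariant_sequence_exact₂ hS k (x - z) (by
    rw [sub_eq_add_neg, Ext.comp_add, Ext.comp_neg, hzx, add_neg_cancel])
  have hmem : x - z ∈ AddSubgroup.closure {y : Ext S.X₂ k p | ∃ (φ : S.X₂ ⟶ k) (w : Ext k k p),
      y = (Ext.mk₀ φ).comp w (zero_add p)} := by
    rw [← hu]
    clear hu
    induction h₃ p u using AddSubgroup.closure_induction with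
    | mem x hx =>
      obtain ⟨φ, w, rfl⟩ := hx
      exact AddSubgroup.subset_closure ⟨S.g ≫ φ, w, by rw [Ext.mk₀_comp_mk₀_assoc]⟩
    | zero => rw [Ext.comp_zero]; exact zero_mem _
    | add x y _ _ hx hy => rw [Ext.comp_add]; exact add_mem hx hy
    | neg x _ hx => rw [Ext.comp_neg]; exact neg_mem hx
  simpa using add_mem hmem hz

include hext in
lemma ExtGenerated.nontrivial_of_left (h₁ : ExtGenerated k S.X₁) {p : ℕ}
    (hp : Nontrivial (Ext S.X₁ k p)) : Nontrivial (Ext S.X₂ k p) := by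
  obtain ⟨x, hx⟩ := exists_ne (0 : Ext S.X₁ k p)
  obtain ⟨z, -, hz⟩ := h₁.exists_restrict_eq hext x
  refine ⟨z, 0, fun h => hx ?_⟩
  rw [← hz, h, Ext.comp_zero]

include hS hext in
lemma ExtGenerated.nontrivial_of_right (h₁ : ExtGenerated k S.X₁) {p : ℕ}
    (hp : Nontrivial (Ext S.X₃ k p)) : Nontrivial (Ext S.X₂ k p) := by
  obtain ⟨x, hx⟩ := exists_ne (0 : Ext S.X₃ k p)
  refine ⟨(Ext.mk₀ S.g).comp x (zero_add p), 0, fun h => hx ?_⟩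
  cases p with
  | zero =>
    have := hS.epi_g
    exact Ext.precomp_mk₀_injective_of_epi k S.g (by simpa using h)
  | succ p =>
    obtain ⟨y, rfl⟩ := Ext.contravariant_sequence_exact₃ hS k x h (add_comm 1 p)
    obtain ⟨z, -, rfl⟩ := h₁.exists_restrict_eq hext y
    exact hS.extClass_comp_assoc z

end ExtGenerated

section ProjDim

open CategoryTheory Abelian

variable (R : Type) [CommRing R]

lemma hasProjDimLE_iff (n : ℕ) (M : Type) [AddCommGroup M] [Module R M] :
    HasProjDimLE R n M ↔ HasProjectiveDimensionLE (ModuleCat.of R M) n := by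
  induction n generalizing M with
  | zero =>
    rw [← projective_iff_hasProjectiveDimensionLE_zero, ← IsProjective.iff_projective]
    rfl
  | succ n ih =>
    constructor
    · rintro ⟨P, _, _, f, hP, hf, hk⟩
      have := LinearMap.shortExact_shortComplexKer hf
      exact (this.hasProjectiveDimensionLT_X₃_iff n
        ((IsProjective.iff_projective P).1 hP)).2 ((ih _).1 hk)
    · intro h
      have hf : Function.Surjective (Finsupp.linearCombination R (id : M → M)) :=
        Finsupp.linearCombination_id_surjective R M
      refine ⟨M →₀ R, inferInstance, inferInstance, Finsupp.linearCombination R id,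
        inferInstance, hf, (ih _).2 ?_⟩
      exact ((LinearMap.shortExact_shortComplexKer hf).hasProjectiveDimensionLT_X₃_iff n
        ((IsProjective.iff_projective (M →₀ R)).1 inferInstance)).1 h

variable {R} in
lemma projDim_eq_of_nontrivial_ext {M : Type} [AddCommGroup M] [Module R M] {p : ℕ}
    (hle : HasProjectiveDimensionLE (ModuleCat.of R M) p) (k : ModuleCat.{0} R)
    (hp : Nontrivial (Ext (ModuleCat.of R M) k p)) : projDim R M = p := by
  refine le_antisymm (sInf_le ⟨p, rfl, (hasProjDimLE_iff R p M).2 hle⟩) (le_sInf ?_)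
  rintro _ ⟨q, rfl, hq⟩
  rw [hasProjDimLE_iff] at hq
  by_contra! hlt
  have := HasProjectiveDimensionLT.subsingleton (ModuleCat.of R M) (q + 1) p
    (by exact_mod_cast hlt) k
  exact not_subsingleton (Ext (ModuleCat.of R M) k p) this

end ProjDim

section VariableQuotient

open CategoryTheory Abelian MvPolynomial

variable {V : Type} (K : Type) [Field K]

/-- The quotient of the polynomial ring by the ideal generated by a set of variables. -/
noncomputable abbrev varQuot (T : Set V) : ModuleCat.{0} (MvPolynomial V K) :=
  ModuleCat.of (MvPolynomial V K)
    (MvPolynomial V K ⧸ (Ideal.span (X '' T) : Ideal (MvPolynomial V K)))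

/-- The projection `S/(T) → S/(U)` for `T ⊆ U`. -/
noncomputable def varQuotFactor {T U : Set V} (h : T ⊆ U) : varQuot K T ⟶ varQuot K U :=
  ModuleCat.ofHom (Submodule.factor (Ideal.span_mono (Set.image_mono h)))

@[simp]
lemma varQuotFactor_comp {T U W : Set V} (h : T ⊆ U) (h' : U ⊆ W) :
    varQuotFactor K h ≫ varQuotFactor K h' = varQuotFactor K (h.trans h') := by
  rw [varQuotFactor, varQuotFactor, varQuotFactor, ← ModuleCat.ofHom_comp, Submodule.factor_comp]

lemma varQuotFactor_refl (T : Set V) : varQuotFactor K (subset_refl T) = 𝟙 _ := by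
  ext : 1
  exact Submodule.linearMap_qext _ rfl

variable {K} in
lemma mem_span_X_image_of_X_mul_mem {T : Set V} {t : V} (ht : t ∉ T) {p : MvPolynomial V K}
    (hp : X t * p ∈ Ideal.span (X '' T : Set (MvPolynomial V K))) :
    p ∈ Ideal.span (X '' T : Set (MvPolynomial V K)) := by
  classical
  rw [mem_ideal_span_X_image] at hp ⊢
  intro m hm
  obtain ⟨i, hi, h⟩ := hp (Finsupp.single t 1 + m) (by
    rw [support_X_mul]
    simpa using hm)
  refine ⟨i, hi, ?_⟩
  have : t ≠ i := fun h => ht (h ▸ hi)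
  simpa [this] using h

/-- The sequence `0 → S/(T) → S/(T) → S/(T ∪ {t}) → 0` given by multiplication by `x_t`. -/
noncomputable def varQuotComplex (T : Set V) (t : V) :
    ShortComplex (ModuleCat.{0} (MvPolynomial V K)) where
  f := (X t : MvPolynomial V K) • 𝟙 (varQuot K T)
  g := varQuotFactor K (Set.subset_insert t T)
  zero := by
    ext : 1
    refine Submodule.linearMap_qext _ (LinearMap.ext_ring ?_)
    refine (Submodule.Quotient.mk_eq_zero _).2 ?_
    change X t * 1 ∈ _
    exact Ideal.mul_mem_right _ _ (Ideal.subset_span ⟨t, Set.mem_insert _ _, rfl⟩)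

lemma varQuotComplex_shortExact {T : Set V} {t : V} (ht : t ∉ T) :
    (varQuotComplex K T t).ShortExact := by
  apply ModuleCat.shortComplex_shortExact
  · intro y
    constructor
    · obtain ⟨p, rfl⟩ := Submodule.Quotient.mk_surjective _ y
      intro h
      replace h := (Submodule.Quotient.mk_eq_zero _).1 h
      rw [Set.image_insert_eq, Ideal.span_insert, Submodule.mem_sup] at h
      obtain ⟨a, ha, b, hb, rfl⟩ := h
      obtain ⟨c, rfl⟩ := Ideal.mem_span_singleton'.1 ha
      refine ⟨Submodule.Quotient.mk c, (Submodule.Quotient.eq _).2 ?_⟩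
      change X t * c - (c * X t + b) ∈ _
      convert neg_mem hb using 1
      ring
    · rintro ⟨x, rfl⟩
      exact ConcreteCategory.congr_hom (varQuotComplex K T t).zero x
  · refine (injective_iff_map_eq_zero (varQuotComplex K T t).f.hom).2 fun y hy => ?_
    obtain ⟨p, rfl⟩ := Submodule.Quotient.mk_surjective _ y
    exact (Submodule.Quotient.mk_eq_zero _).2
      (mem_span_X_image_of_X_mul_mem ht ((Submodule.Quotient.mk_eq_zero _).1 hy))
  · exact Submodule.factor_surjective (Ideal.span_mono (Set.image_mono (Set.subset_insert t T)))

lemma X_smul_id_varQuot_univ (t : V) :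
    (X t : MvPolynomial V K) • 𝟙 (varQuot K (Set.univ : Set V)) = 0 := by
  ext : 1
  refine Submodule.linearMap_qext _ (LinearMap.ext_ring ?_)
  refine (Submodule.Quotient.mk_eq_zero _).2 ?_
  change X t * 1 ∈ _
  exact Ideal.mul_mem_right _ _ (Ideal.subset_span ⟨t, Set.mem_univ _, rfl⟩)

lemma varQuotComplex_f_comp_ext (T : Set V) (t : V) {p : ℕ}
    (x : Ext (varQuot K T) (varQuot K (Set.univ : Set V)) p) :
    (Ext.mk₀ (varQuotComplex K T t).f).comp x (zero_add p) = 0 := by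
  change (Ext.mk₀ ((X t : MvPolynomial V K) • 𝟙 (varQuot K T))).comp x _ = 0
  rw [Ext.mk₀_smul, Ext.smul_comp, Ext.mk₀_id_comp, Ext.smul_eq_comp_mk₀,
    X_smul_id_varQuot_univ, Ext.mk₀_zero, Ext.comp_zero]

lemma exists_varQuotFactor_insert_comp_eq {T : Set V} {t : V} (ht : t ∉ T) {p : ℕ}
    (x : Ext (varQuot K T) (varQuot K (Set.univ : Set V)) p) :
    ∃ y : Ext (varQuot K (insert t T)) (varQuot K (Set.univ : Set V)) p,
      (Ext.mk₀ (varQuotFactor K (Set.subset_insert t T))).comp y (zero_add p) = x :=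
  Ext.contravariant_sequence_exact₂ (varQuotComplex_shortExact K ht) _ x
    (varQuotComplex_f_comp_ext K T t x)

lemma exists_varQuotFactor_comp_eq [Finite V] {T U : Set V} (h : T ⊆ U) {p : ℕ}
    (x : Ext (varQuot K T) (varQuot K (Set.univ : Set V)) p) :
    ∃ y : Ext (varQuot K U) (varQuot K (Set.univ : Set V)) p,
      (Ext.mk₀ (varQuotFactor K h)).comp y (zero_add p) = x := by
  suffices H : ∀ A : Set V, ∀ U, U = T ∪ A → ∀ h : T ⊆ U,
      ∃ y : Ext (varQuot K U) (varQuot K (Set.univ : Set V)) p,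
        (Ext.mk₀ (varQuotFactor K h)).comp y (zero_add p) = x from
    H U U (Set.union_eq_self_of_subset_left h).symm h
  intro A
  induction A, A.toFinite using Set.Finite.induction_on with
  | empty =>
    rintro U hU h
    rw [Set.union_empty] at hU
    subst hU
    exact ⟨x, by rw [varQuotFactor_refl, Ext.mk₀_id_comp]⟩
  | @insert a A _ _ ih =>
    rintro U rfl h
    obtain ⟨y, rfl⟩ := ih _ rfl Set.subset_union_left
    by_cases ha : a ∈ T ∪ A
    · have e : T ∪ insert a A = T ∪ A := by rw [Set.union_insert, Set.insert_eq_of_mem ha]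
      revert h
      rw [e]
      exact fun h => ⟨y, rfl⟩
    · obtain ⟨z, rfl⟩ := exists_varQuotFactor_insert_comp_eq K ha y
      revert h
      rw [Set.union_insert]
      exact fun h => ⟨z, by rw [Ext.mk₀_comp_mk₀_assoc, varQuotFactor_comp]⟩

lemma extGenerated_varQuot [Finite V] (T : Set V) :
    ExtGenerated (varQuot K (Set.univ : Set V)) (varQuot K T) :=
  .of_surjective (varQuotFactor K (Set.subset_univ T)) fun _ x =>
    exists_varQuotFactor_comp_eq K (Set.subset_univ T) x

lemma varQuotFactor_ne_zero {T U : Set V} (h : T ⊆ U) : varQuotFactor K h ≠ 0 := by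
  intro h0
  have := ConcreteCategory.congr_hom h0 (Submodule.Quotient.mk 1)
  replace this := (Submodule.Quotient.mk_eq_zero _).1 this
  simp [mem_ideal_span_X_image] at this

lemma nontrivial_ext_varQuot (T : Finset V) :
    Nontrivial (Ext (varQuot K (T : Set V)) (varQuot K (Set.univ : Set V)) T.card) := by
  classical
  induction T using Finset.induction_on with
  | empty =>
    rw [Finset.card_empty]
    exact ⟨Ext.mk₀ (varQuotFactor K (Set.subset_univ _)), 0, fun h =>
      varQuotFactor_ne_zero K _ ((Ext.mk₀_eq_zero_iff _).1 h)⟩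
  | insert t T ht ih =>
    rw [Finset.card_insert_of_notMem ht, Finset.coe_insert]
    obtain ⟨x, hx⟩ := exists_ne
      (0 : Ext (varQuot K (T : Set V)) (varQuot K (Set.univ : Set V)) T.card)
    have hS := varQuotComplex_shortExact K (T := (T : Set V)) (t := t) (by simpa using ht)
    refine ⟨hS.extClass.comp x (add_comm _ _), 0, fun h => hx ?_⟩
    obtain ⟨y, rfl⟩ := Ext.contravariant_sequence_exact₁ hS _ x (add_comm _ _) h
    exact varQuotComplex_f_comp_ext K _ t y

lemma hasProjectiveDimensionLE_varQuot (T : Finset V) :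
    HasProjectiveDimensionLE (varQuot K (T : Set V)) T.card := by
  classical
  induction T using Finset.induction_on with
  | empty =>
    rw [Finset.card_empty, ← projective_iff_hasProjectiveDimensionLE_zero,
      ← IsProjective.iff_projective]
    have e : (Ideal.span (X '' ((∅ : Finset V) : Set V)) : Ideal (MvPolynomial V K)) = ⊥ := by
      simp
    exact Module.Projective.of_equiv (Submodule.quotEquivOfEqBot _ e).symm
  | insert t T ht ih =>
    rw [Finset.card_insert_of_notMem ht, Finset.coe_insert]
    have hS := varQuotComplex_shortExact K (T := (T : Set V)) (t := t) (by simpa using ht)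
    have h₂ : HasProjectiveDimensionLT (varQuotComplex K (T : Set V) t).X₂ (T.card + 1) := ih
    exact hS.hasProjectiveDimensionLT_X₃ (T.card + 1) ih inferInstance

end VariableQuotient

section SquarefreeIdeal

open CategoryTheory Abelian MvPolynomial

variable {V : Type} (K : Type) [Field K]

/-- The squarefree monomial ideal generated by the monomials `x^F` for `F ∈ 𝓕`. -/
noncomputable abbrev sqfreeIdeal (𝓕 : Set (Finset V)) : Ideal (MvPolynomial V K) :=
  Ideal.span ((fun F => ∏ v ∈ F, X v) '' 𝓕)

lemma prod_X_eq_monomial (F : Finset V) :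
    (∏ v ∈ F, X v : MvPolynomial V K) = monomial (∑ v ∈ F, Finsupp.single v 1) 1 :=
  (monomial_sum_one F _).symm

lemma sum_single_one_apply [DecidableEq V] (F : Finset V) (v : V) :
    (∑ w ∈ F, Finsupp.single w 1 : V →₀ ℕ) v = if v ∈ F then 1 else 0 := by
  simp [Finsupp.finsetSum_apply, Finsupp.single_apply]

lemma sum_single_one_le_iff (F : Finset V) (m : V →₀ ℕ) :
    (∑ w ∈ F, Finsupp.single w 1 : V →₀ ℕ) ≤ m ↔ ∀ v ∈ F, m v ≠ 0 := by
  classical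
  simp only [Finsupp.le_def, sum_single_one_apply]
  refine forall_congr' fun v => ?_
  split_ifs with h <;> simp [h, Nat.one_le_iff_ne_zero]

variable {K}

lemma mem_sqfreeIdeal {𝓕 : Set (Finset V)} {p : MvPolynomial V K} :
    p ∈ sqfreeIdeal K 𝓕 ↔ ∀ m ∈ p.support, ∃ F ∈ 𝓕, ∀ v ∈ F, m v ≠ 0 := by
  have := mem_ideal_span_monomial_image (R := K) (x := p)
    (s := (fun F : Finset V => ∑ v ∈ F, Finsupp.single v 1) '' 𝓕)
  rw [Set.image_image] at this
  simp only [sqfreeIdeal, prod_X_eq_monomial, this, Set.exists_mem_image, sum_single_one_le_iff]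

lemma mul_prod_X_mem_sqfreeIdeal {𝓕 : Set (Finset V)} {p : MvPolynomial V K} {F : Finset V} :
    p * ∏ v ∈ F, X v ∈ sqfreeIdeal K 𝓕 ↔
      ∀ m ∈ p.support, ∃ G ∈ 𝓕, ∀ v ∈ G, v ∉ F → m v ≠ 0 := by
  classical
  rw [mem_sqfreeIdeal, prod_X_eq_monomial]
  constructor
  · intro h m hm
    obtain ⟨G, hG, hGm⟩ := h (m + ∑ v ∈ F, Finsupp.single v 1) (by
      rw [mem_support_iff, coeff_mul_monomial, mul_one]
      exact mem_support_iff.1 hm)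
    refine ⟨G, hG, fun v hv hvF => ?_⟩
    have := hGm v hv
    rwa [Finsupp.add_apply, sum_single_one_apply, if_neg hvF, add_zero] at this
  · intro h m hm
    rw [mem_support_iff, coeff_mul_monomial'] at hm
    split_ifs at hm with hle
    · rw [mul_one] at hm
      obtain ⟨G, hG, hGm⟩ := h _ (mem_support_iff.2 hm)
      refine ⟨G, hG, fun v hv => ?_⟩
      by_cases hvF : v ∈ F
      · exact (sum_single_one_le_iff F m).1 hle v hvF
      · have := hGm v hv hvF
        rw [Finsupp.tsub_apply] at this
        omega
    · exact (hm rfl).elim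

lemma X_mul_prod_X_mem_sqfreeIdeal_iff [DecidableEq V] {𝓕 : Set (Finset V)} {t : V}
    {F : Finset V} :
    X t * ∏ v ∈ F, X v ∈ sqfreeIdeal K 𝓕 ↔ ∃ G ∈ 𝓕, G ⊆ insert t F := by
  rw [mul_prod_X_mem_sqfreeIdeal]
  simp only [support_X, Finset.mem_singleton, forall_eq, Finsupp.single_apply, ne_eq]
  refine exists_congr fun G => and_congr_right fun _ => forall₂_congr fun v hv => ?_
  simp only [Finset.mem_insert]
  grind

/-- The combinatorial form of `(x^G : G ∈ 𝓕) : x^F = (x_t : t ∈ T)`. -/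
structure LinearColon [DecidableEq V] (𝓕 : Set (Finset V)) (F T : Finset V) : Prop where
  exists_subset : ∀ t ∈ T, ∃ G ∈ 𝓕, G ⊆ insert t F
  exists_mem : ∀ G ∈ 𝓕, ∃ t ∈ T, t ∈ G ∧ t ∉ F

variable [DecidableEq V] {𝓕 : Set (Finset V)} {F T : Finset V}

namespace LinearColon

lemma disjoint (h : LinearColon 𝓕 F T) : Disjoint T F := by
  refine Finset.disjoint_left.2 fun t ht htF => ?_
  obtain ⟨G, hG, hGt⟩ := h.exists_subset t ht
  obtain ⟨u, -, huG, huF⟩ := h.exists_mem G hG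
  rw [Finset.insert_eq_of_mem htF] at hGt
  exact huF (hGt huG)

lemma mul_prod_X_mem_iff (h : LinearColon 𝓕 F T) {p : MvPolynomial V K} :
    p * ∏ v ∈ F, X v ∈ sqfreeIdeal K 𝓕 ↔
      p ∈ Ideal.span (X '' (T : Set V) : Set (MvPolynomial V K)) := by
  constructor
  · rw [mul_prod_X_mem_sqfreeIdeal, mem_ideal_span_X_image]
    intro hp m hm
    obtain ⟨G, hG, hGm⟩ := hp m hm
    obtain ⟨t, ht, htG, htF⟩ := h.exists_mem G hG
    exact ⟨t, ht, hGm t htG htF⟩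
  · rw [mul_prod_X_mem_sqfreeIdeal, mem_ideal_span_X_image]
    intro hp m hm
    obtain ⟨t, ht, hmt⟩ := hp m hm
    obtain ⟨G, hG, hGt⟩ := h.exists_subset t ht
    refine ⟨G, hG, fun v hv hvF => ?_⟩
    rwa [(Finset.mem_insert.1 (hGt hv)).resolve_right hvF]

lemma exists_X_mul_eq (h : LinearColon 𝓕 F T) (hcard : ∀ G ∈ 𝓕, G.card = F.card) {t : V}
    (ht : t ∈ T) : ∃ G ∈ 𝓕, ∃ u : V,
      (X t * ∏ v ∈ F, X v : MvPolynomial V K) = X u * ∏ v ∈ G, X v := by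
  obtain ⟨G, hG, hGt⟩ := h.exists_subset t ht
  have htF := Finset.disjoint_left.1 h.disjoint ht
  obtain ⟨u, hu, e⟩ := Finset.exists_eq_insert_iff.2 ⟨hGt, by
    rw [hcard G hG, Finset.card_insert_of_notMem htF]⟩
  refine ⟨G, hG, u, ?_⟩
  rw [← Finset.prod_insert htF, ← e, Finset.prod_insert hu]

variable (K) in
lemma exists_shortExact (h : LinearColon 𝓕 F T) :
    ∃ (g : ModuleCat.of (MvPolynomial V K) (sqfreeIdeal K (insert F 𝓕)) ⟶ varQuot K (T : Set V))
      (w : ModuleCat.ofHom (Submodule.inclusion (Ideal.span_mono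
        (Set.image_mono (Set.subset_insert F 𝓕)) :
          sqfreeIdeal K 𝓕 ≤ sqfreeIdeal K (insert F 𝓕))) ≫ g = 0),
      (ShortComplex.mk _ g w).ShortExact := by
  have hle : sqfreeIdeal K 𝓕 ≤ sqfreeIdeal K (insert F 𝓕) :=
    Ideal.span_mono (Set.image_mono (Set.subset_insert F 𝓕))
  have hF : ∏ v ∈ F, X v ∈ sqfreeIdeal K (insert F 𝓕) :=
    Ideal.subset_span ⟨F, Set.mem_insert _ _, rfl⟩
  let φ : MvPolynomial V K →ₗ[MvPolynomial V K]
      (sqfreeIdeal K (insert F 𝓕) ⧸ (sqfreeIdeal K 𝓕).submoduleOf (sqfreeIdeal K (insert F 𝓕))) :=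
    (Submodule.mkQ _).comp (LinearMap.toSpanSingleton _ _ ⟨∏ v ∈ F, X v, hF⟩)
  have hφker : LinearMap.ker φ = Ideal.span (X '' (T : Set V)) := by
    ext p
    rw [← h.mul_prod_X_mem_iff, LinearMap.mem_ker]
    exact Submodule.Quotient.mk_eq_zero _
  have hφsurj : Function.Surjective φ := by
    intro y
    obtain ⟨⟨y, hy⟩, rfl⟩ := Submodule.Quotient.mk_surjective _ y
    have hy' := hy
    rw [sqfreeIdeal, Set.image_insert_eq, Ideal.span_insert, Submodule.mem_sup] at hy'
    obtain ⟨a, ha, b, hb, rfl⟩ := hy'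
    obtain ⟨c, rfl⟩ := Ideal.mem_span_singleton'.1 ha
    refine ⟨c, (Submodule.Quotient.eq _).2 ?_⟩
    change c * _ - (c * _ + b) ∈ sqfreeIdeal K 𝓕
    rw [sub_add_cancel_left]
    exact neg_mem hb
  let e := (Submodule.quotEquivOfEq _ _ hφker).symm.trans
    (φ.quotKerEquivOfSurjective hφsurj)
  have hexact : Function.Exact (Submodule.inclusion hle)
      (e.symm.toLinearMap.comp (Submodule.mkQ _)) := by
    intro y
    rw [LinearMap.comp_apply, LinearEquiv.coe_coe, LinearEquiv.map_eq_zero_iff,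
      Submodule.mkQ_apply, Submodule.Quotient.mk_eq_zero]
    exact ⟨fun hy => ⟨⟨y, hy⟩, rfl⟩, by rintro ⟨x, rfl⟩; exact x.2⟩
  refine ⟨ModuleCat.ofHom (e.symm.toLinearMap.comp (Submodule.mkQ _)), ?_, ?_⟩
  · ext x
    exact hexact.apply_apply_eq_zero x
  · exact ModuleCat.shortComplex_shortExact _ hexact (Submodule.inclusion_injective hle)
      (e.symm.surjective.comp (Submodule.mkQ_surjective _))

lemma exists_extension (h : LinearColon 𝓕 F T) (hcard : ∀ G ∈ 𝓕, G.card = F.card)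
    (φ : sqfreeIdeal K 𝓕 →ₗ[MvPolynomial V K] varQuot K (Set.univ : Set V)) :
    ∃ ψ : sqfreeIdeal K (insert F 𝓕) →ₗ[MvPolynomial V K] varQuot K (Set.univ : Set V),
      ψ.comp (Submodule.inclusion
        (Ideal.span_mono (Set.image_mono (Set.subset_insert F 𝓕)))) = φ := by
  have hkill (u : V) (x : varQuot K (Set.univ : Set V)) : (X u : MvPolynomial V K) • x = 0 :=
    ConcreteCategory.congr_hom (X_smul_id_varQuot_univ K u) x
  have key (p : MvPolynomial V K)
      (hp : p ∈ Ideal.span (X '' (T : Set V) : Set (MvPolynomial V K))) :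
      ∃ hp : p * ∏ v ∈ F, X v ∈ sqfreeIdeal K 𝓕, φ ⟨_, hp⟩ = 0 := by
    induction hp using Submodule.span_induction with
    | mem x hx =>
      obtain ⟨t, ht, rfl⟩ := hx
      obtain ⟨G, hG, u, e⟩ := h.exists_X_mul_eq (K := K) hcard ht
      have hG' : ∏ v ∈ G, X v ∈ sqfreeIdeal K 𝓕 := Ideal.subset_span ⟨G, hG, rfl⟩
      simp only [e]
      refine ⟨Ideal.mul_mem_left _ _ hG', ?_⟩
      exact (φ.map_smul (X u) ⟨_, hG'⟩).trans (hkill u _)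
    | zero =>
      simp only [zero_mul]
      exact ⟨zero_mem _, φ.map_zero⟩
    | add x y _ _ hx hy =>
      obtain ⟨hx, hx'⟩ := hx
      obtain ⟨hy, hy'⟩ := hy
      simp only [add_mul]
      refine ⟨add_mem hx hy, ?_⟩
      exact (φ.map_add ⟨_, hx⟩ ⟨_, hy⟩).trans (by rw [hx', hy', add_zero])
    | smul a x _ hx =>
      obtain ⟨hx, hx'⟩ := hx
      simp only [smul_eq_mul, mul_assoc]
      refine ⟨Ideal.mul_mem_left _ a hx, ?_⟩
      exact (φ.map_smul a ⟨_, hx⟩).trans (by rw [hx', smul_zero])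
  let f₁ : MvPolynomial V K →ₗ.[MvPolynomial V K] varQuot K (Set.univ : Set V) :=
    ⟨sqfreeIdeal K 𝓕, φ⟩
  let f₂ : MvPolynomial V K →ₗ.[MvPolynomial V K] varQuot K (Set.univ : Set V) :=
    ⟨Ideal.span {∏ v ∈ F, X v}, 0⟩
  have H (x : f₁.domain) (y : f₂.domain) (hxy : (x : MvPolynomial V K) = y) : f₁ x = f₂ y := by
    obtain ⟨x, hx⟩ := x
    obtain ⟨y, hy⟩ := y
    obtain ⟨c, rfl⟩ := Ideal.mem_span_singleton'.1 hy
    change x = _ at hxy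
    subst hxy
    obtain ⟨_, hc⟩ := key c (h.mul_prod_X_mem_iff.1 hx)
    exact hc
  have hdom : sqfreeIdeal K (insert F 𝓕) ≤ (f₁.sup f₂ H).domain := by
    rw [sqfreeIdeal, Set.image_insert_eq, Ideal.span_insert, sup_comm]
    exact le_refl _
  refine ⟨(f₁.sup f₂ H).toFun.comp (Submodule.inclusion hdom), ?_⟩
  ext1 x
  exact ((LinearPMap.left_le_sup f₁ f₂ H).2 rfl).symm

end LinearColon

lemma extGenerated_sqfreeIdeal [Finite V] {ι : Type*} [LinearOrder ι] (F T : ι → Finset V)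
    (A : Finset ι) (hcard : ∀ i ∈ A, ∀ j ∈ A, (F i).card = (F j).card)
    (hA : ∀ i ∈ A, LinearColon (F '' {j | j ∈ A ∧ j < i}) (F i) (T i)) :
    ExtGenerated (varQuot K (Set.univ : Set V))
        (ModuleCat.of (MvPolynomial V K) (sqfreeIdeal K (F '' (A : Set ι)))) ∧
      (∀ N, (∀ i ∈ A, (T i).card ≤ N) → HasProjectiveDimensionLE
        (ModuleCat.of (MvPolynomial V K) (sqfreeIdeal K (F '' (A : Set ι)))) N) ∧
      ∀ i ∈ A, Nontrivial (Ext (ModuleCat.of (MvPolynomial V K)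
        (sqfreeIdeal K (F '' (A : Set ι)))) (varQuot K (Set.univ : Set V)) (T i).card) := by
  induction A using Finset.induction_on_max with
  | empty =>
    have : Subsingleton (sqfreeIdeal K (F '' ((∅ : Finset ι) : Set ι))) := by
      rw [Finset.coe_empty, Set.image_empty, sqfreeIdeal, Set.image_empty, Ideal.span_empty]
      infer_instance
    have hz := ModuleCat.isZero_of_subsingleton
      (ModuleCat.of (MvPolynomial V K) (sqfreeIdeal K (F '' ((∅ : Finset ι) : Set ι))))
    have h0 := hz.hasProjectiveDimensionLT_zero
    refine ⟨fun p x => ?_, fun N _ => hasProjectiveDimensionLT_of_ge _ 0 _ (Nat.zero_le _),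
      fun i hi => by simp at hi⟩
    rw [x.eq_zero_of_hasProjectiveDimensionLT 0 (Nat.zero_le _)]
    exact zero_mem _
  | insert a A ha ih =>
    have haA : a ∉ A := fun h => lt_irrefl _ (ha a h)
    obtain ⟨ih₁, ih₂, ih₃⟩ := ih (fun i hi j hj => hcard i (Finset.mem_insert_of_mem hi) j
      (Finset.mem_insert_of_mem hj)) fun i hi => by
        have e : {j | j ∈ A ∧ j < i} = {j | j ∈ insert a A ∧ j < i} := by
          ext j
          have := ha i hi
          simp only [Set.mem_ofPred_eq, Finset.mem_insert]
          grind
        rw [e]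
        exact hA i (Finset.mem_insert_of_mem hi)
    have hcol : LinearColon (F '' (A : Set ι)) (F a) (T a) := by
      have e : (A : Set ι) = {j | j ∈ insert a A ∧ j < a} := by
        ext j
        simp only [Set.mem_ofPred_eq, Finset.mem_insert, Finset.mem_coe]
        grind
      rw [e]
      exact hA a (Finset.mem_insert_self a A)
    have hc : ∀ G ∈ F '' (A : Set ι), G.card = (F a).card := by
      rintro _ ⟨i, hi, rfl⟩
      exact hcard i (Finset.mem_insert_of_mem hi) a (Finset.mem_insert_self a A)
    rw [Finset.coe_insert, Set.image_insert_eq]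
    obtain ⟨g, w, hS⟩ := hcol.exists_shortExact K
    have hext (φ : ModuleCat.of (MvPolynomial V K) (sqfreeIdeal K (F '' (A : Set ι))) ⟶
        varQuot K (Set.univ : Set V)) : ∃ ψ, (ShortComplex.mk _ g w).f ≫ ψ = φ := by
      obtain ⟨ψ, hψ⟩ := hcol.exists_extension hc φ.hom
      exact ⟨ModuleCat.ofHom ψ, ModuleCat.hom_ext hψ⟩
    refine ⟨ih₁.extension hS hext (extGenerated_varQuot K _), fun N hN => ?_, fun i hi => ?_⟩
    · have h₃ := hasProjectiveDimensionLE_varQuot K (T a)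
      exact hS.hasProjectiveDimensionLT_X₂ (N + 1)
        (ih₂ N fun i hi => hN i (Finset.mem_insert_of_mem hi))
        (hasProjectiveDimensionLT_of_ge _ ((T a).card + 1) _
          (Nat.succ_le_succ (hN a (Finset.mem_insert_self a A))))
    · rcases Finset.mem_insert.1 hi with rfl | hi
      · exact ih₁.nontrivial_of_right hS hext (nontrivial_ext_varQuot K _)
      · exact ih₁.nontrivial_of_left (S := ShortComplex.mk _ g w) hext (ih₃ i hi)

/-- Orders with linear quotients of a family of squarefree monomials of equal degree: the
projective dimension of the ideal is the largest number of variables generating a colon ideal. -/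
lemma projDim_sqfreeIdeal [Finite V] {ι : Type*} [LinearOrder ι] (F T : ι → Finset V)
    (A : Finset ι) (hcard : ∀ i ∈ A, ∀ j ∈ A, (F i).card = (F j).card)
    (hA : ∀ i ∈ A, LinearColon (F '' {j | j ∈ A ∧ j < i}) (F i) (T i)) {p : ℕ}
    (hle : ∀ i ∈ A, (T i).card ≤ p) (hp : ∃ i ∈ A, (T i).card = p) :
    projDim (MvPolynomial V K) (sqfreeIdeal K (F '' (A : Set ι))) = p := by
  obtain ⟨-, h₂, h₃⟩ := extGenerated_sqfreeIdeal (K := K) F T A hcard hA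
  obtain ⟨i, hi, rfl⟩ := hp
  exact projDim_eq_of_nontrivial_ext (h₂ _ hle) _ (h₃ i hi)

end SquarefreeIdeal

section Expansion

open MvPolynomial

variable {V : Type} [DecidableEq V] {K : Type} [Field K]

lemma linearColon_of_colon_eq {𝓕 : Set (Finset V)} {F T : Finset V}
    (h : (sqfreeIdeal K 𝓕).colon (Ideal.span {(∏ v ∈ F, X v : MvPolynomial V K)}) =
      Ideal.span (X '' (T : Set V))) : LinearColon 𝓕 F T where
  exists_subset t ht := by
    rw [← X_mul_prod_X_mem_sqfreeIdeal_iff (K := K), ← Ideal.mem_colon_span_singleton, h]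
    exact Ideal.subset_span ⟨t, ht, rfl⟩
  exists_mem G hG := by
    have hmem : (∏ v ∈ G \ F, X v : MvPolynomial V K) ∈
        (sqfreeIdeal K 𝓕).colon (Ideal.span {(∏ v ∈ F, X v : MvPolynomial V K)}) := by
      rw [Ideal.mem_colon_span_singleton, mul_prod_X_mem_sqfreeIdeal, prod_X_eq_monomial]
      intro m hm
      refine ⟨G, hG, fun v hv hvF => ?_⟩
      rw [Finset.mem_singleton.1 (support_monomial_subset hm), sum_single_one_apply,
        if_pos (Finset.mem_sdiff.2 ⟨hv, hvF⟩)]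
      exact one_ne_zero
    rw [h, mem_ideal_span_X_image, prod_X_eq_monomial] at hmem
    obtain ⟨t, ht, htm⟩ := hmem _ (by
      rw [mem_support_iff, coeff_monomial, if_pos rfl]
      exact one_ne_zero)
    rw [sum_single_one_apply] at htm
    exact ⟨t, ht, Finset.mem_sdiff.1 (by_contra fun hn => htm (if_neg hn))⟩

lemma HasLinearQuotients.exists_linearColon [Finite V] {Δ : Set (Finset V)}
    (h : HasLinearQuotients K Δ) :
    ∃ (m : ℕ) (f T : Fin m → Finset V), Set.range f = {F | IsFacet Δ F} ∧
      ∀ i, LinearColon (f '' {j | j < i}) (f i) (T i) := by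
  obtain ⟨m, f, -, hr, hT⟩ := h
  suffices H : ∀ i, ∃ T : Finset V, LinearColon (f '' {j | j < i}) (f i) T by
    choose T hT using H
    exact ⟨m, f, T, hr, hT⟩
  intro i
  rcases Nat.eq_zero_or_pos i.val with hi | hi
  · refine ⟨∅, ⟨by simp, ?_⟩⟩
    rintro _ ⟨j, hj, rfl⟩
    have : j.val < i.val := hj
    omega
  · obtain ⟨T, hT⟩ := hT i hi
    obtain ⟨T, rfl⟩ := T.toFinite.exists_finset_coe
    exact ⟨T, linearColon_of_colon_eq hT⟩

variable {s : ℕ}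

/-- The face `{(v, c v) : v ∈ F}` of the expansion. -/
def expansionFace (F : Finset V) (c : V → Fin s) : Finset ((_ : V) × Fin s) :=
  F.image fun v => ⟨v, c v⟩

@[simp]
lemma mem_expansionFace {F : Finset V} {c : V → Fin s} {x : (_ : V) × Fin s} :
    x ∈ expansionFace F c ↔ x.1 ∈ F ∧ x.2 = c x.1 := by
  obtain ⟨v, j⟩ := x
  simp only [expansionFace, Finset.mem_image, Sigma.mk.injEq, heq_eq_eq]
  grind

lemma card_expansionFace (F : Finset V) (c : V → Fin s) : (expansionFace F c).card = F.card :=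
  Finset.card_image_of_injective _ fun _ _ h => congrArg Sigma.fst h

lemma expansionFace_mem_expansion {Δ : Set (Finset V)} {F : Finset V} (hF : F ∈ Δ)
    (c : V → Fin s) : expansionFace F c ∈ expansion Δ fun _ => s := by
  refine Set.mem_biUnion hF ⟨?_, ?_⟩
  · intro v
    simp only [Finset.mem_image, mem_expansionFace]
    rintro ⟨x, ⟨hx, -⟩, rfl⟩
    exact hx
  · rintro ⟨v, j⟩ hx ⟨w, k⟩ hy (rfl : v = w)
    rw [Finset.mem_coe, mem_expansionFace] at hx hy
    simp_all

lemma isFacet_expansion_iff [Finite V] [NeZero s] {Δ : Set (Finset V)}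
    {G : Finset ((_ : V) × Fin s)} :
    IsFacet (expansion Δ fun _ => s) G ↔
      ∃ F, IsFacet Δ F ∧ ∃ c : V → Fin s, G = expansionFace F c := by
  constructor
  · rintro ⟨hG, hmax⟩
    obtain ⟨F₀, hF₀, hGF₀, hinj⟩ := Set.mem_iUnion₂.1 hG
    obtain ⟨F, hle, hF⟩ := (Set.toFinite Δ).exists_le_maximal hF₀
    have hFacet : IsFacet Δ F := ⟨hF.1, fun H hH hFH => le_antisymm hFH (hF.2 hH hFH)⟩
    have hc (v : V) : ∃ c : Fin s, ∀ j, (⟨v, j⟩ : (_ : V) × Fin s) ∈ G → j = c := by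
      by_cases h : ∃ j, (⟨v, j⟩ : (_ : V) × Fin s) ∈ G
      · obtain ⟨k, hk⟩ := h
        exact ⟨k, fun j hj => eq_of_heq (Sigma.mk.inj (hinj hj hk rfl)).2⟩
      · exact ⟨0, fun j hj => (h ⟨j, hj⟩).elim⟩
    choose c hc using hc
    refine ⟨F, hFacet, c, hmax _ (expansionFace_mem_expansion hF.1 c) ?_⟩
    rintro ⟨v, j⟩ hx
    exact mem_expansionFace.2 ⟨hle (hGF₀ (Finset.mem_image_of_mem Sigma.fst hx)), hc v j hx⟩
  · rintro ⟨F, hF, c, rfl⟩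
    refine ⟨expansionFace_mem_expansion hF.1 c, fun H hH hle => ?_⟩
    obtain ⟨F', hF', hHF', hinj⟩ := Set.mem_iUnion₂.1 hH
    have hFF' : F = F' := hF.2 F' hF' fun v hv => hHF' (Finset.mem_image.2
      ⟨⟨v, c v⟩, hle (mem_expansionFace.2 ⟨hv, rfl⟩), rfl⟩)
    refine Finset.eq_of_subset_of_card_le hle ?_
    rw [card_expansionFace, hFF', ← Finset.card_image_of_injOn hinj]
    exact Finset.card_le_card hHF'

/-- The variables generating the colon ideal at the generator `expansionFace F c`, where `T` is
the set of variables generating the colon ideal at `F`. -/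
def expansionColon (F T : Finset V) (c : V → Fin s) : Finset ((_ : V) × Fin s) :=
  (T.sigma fun _ => Finset.univ) ∪ F.sigma fun v => Finset.Iio (c v)

lemma mem_expansionColon {F T : Finset V} {c : V → Fin s} {x : (_ : V) × Fin s} :
    x ∈ expansionColon F T c ↔ x.1 ∈ T ∨ x.1 ∈ F ∧ x.2 < c x.1 := by
  simp [expansionColon]

lemma card_expansionColon {F T : Finset V} (h : Disjoint T F) (c : V → Fin s) :
    (expansionColon F T c).card = T.card * s + ∑ v ∈ F, (c v : ℕ) := by
  rw [expansionColon, Finset.card_union_of_disjoint, Finset.card_sigma, Finset.card_sigma]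
  · simp
  · rw [Finset.disjoint_left] at h ⊢
    intro x hx hx'
    exact h (Finset.mem_sigma.1 hx).1 (Finset.mem_sigma.1 hx').1

lemma linearColon_expansion [NeZero s] {n m : ℕ} {f T : Fin m → Finset (Fin n)}
    (h : ∀ i, LinearColon (f '' {j | j < i}) (f i) (T i))
    (A : Finset (Fin m ×ₗ Lex (Fin n → Fin s)))
    (hA : ∀ x, x ∈ A ↔ ∀ v ∉ f (ofLex x).1, ofLex (ofLex x).2 v = 0) :
    ∀ x ∈ A, LinearColon
      ((fun y : Fin m ×ₗ Lex (Fin n → Fin s) => expansionFace (f (ofLex y).1) (ofLex (ofLex y).2)) ''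
        {y | y ∈ A ∧ y < x})
      (expansionFace (f (ofLex x).1) (ofLex (ofLex x).2))
      (expansionColon (f (ofLex x).1) (T (ofLex x).1) (ofLex (ofLex x).2)) := by
  intro x hx
  obtain ⟨⟨i, c⟩, rfl⟩ := toLex.surjective x
  obtain ⟨c, rfl⟩ := toLex.surjective c
  simp only [ofLex_toLex]
  have hc := (hA _).1 hx
  simp only [ofLex_toLex] at hc
  constructor
  · rintro ⟨v, j⟩ hvj
    rcases mem_expansionColon.1 hvj with hv | ⟨hv, hj⟩
    · obtain ⟨_, ⟨k, hk, rfl⟩, hks⟩ := (h i).exists_subset v hv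
      refine ⟨_, ⟨toLex (k, toLex fun w => if w ∈ f k then Function.update c v j w else 0),
        ⟨(hA _).2 fun w hw => ?_, ?_⟩, rfl⟩, ?_⟩
      · exact if_neg hw
      · exact Prod.Lex.lt_iff.2 (Or.inl hk)
      · rintro ⟨w, l⟩ hw
        rw [mem_expansionFace] at hw
        obtain ⟨hwk, hl⟩ := hw
        simp only [ofLex_toLex] at hwk hl
        rw [if_pos hwk] at hl
        subst hl
        by_cases hwv : w = v
        · subst hwv
          simp
        · rw [Function.update_of_ne hwv, Finset.mem_insert, mem_expansionFace]
          exact Or.inr ⟨(Finset.mem_insert.1 (hks hwk)).resolve_left hwv, rfl⟩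
    · refine ⟨_, ⟨toLex (i, toLex (Function.update c v j)), ⟨(hA _).2 fun w hw => ?_, ?_⟩, rfl⟩, ?_⟩
      · have : w ≠ v := fun e => hw (e ▸ hv)
        simp only [ofLex_toLex] at hw ⊢
        rw [Function.update_of_ne this]
        exact hc w hw
      · exact Prod.Lex.lt_iff.2 (Or.inr ⟨rfl, Pi.toLex_update_lt_self_iff.2 hj⟩)
      · rintro ⟨w, l⟩ hw
        rw [mem_expansionFace] at hw
        obtain ⟨hwi, hl⟩ := hw
        simp only [ofLex_toLex] at hwi hl
        subst hl
        by_cases hwv : w = v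
        · subst hwv
          simp
        · rw [Function.update_of_ne hwv, Finset.mem_insert, mem_expansionFace]
          exact Or.inr ⟨hwi, rfl⟩
  · rintro _ ⟨y, ⟨hy, hlt⟩, rfl⟩
    obtain ⟨⟨k, c'⟩, rfl⟩ := toLex.surjective y
    obtain ⟨c', rfl⟩ := toLex.surjective c'
    rcases Prod.Lex.lt_iff.1 hlt with hki | ⟨hki, hcc⟩
    · obtain ⟨t, ht, htk, hti⟩ := (h i).exists_mem (f k) ⟨k, hki, rfl⟩
      refine ⟨⟨t, c' t⟩, mem_expansionColon.2 (Or.inl ht), mem_expansionFace.2 ⟨htk, rfl⟩, ?_⟩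
      rw [mem_expansionFace]
      exact fun hn => hti hn.1
    · change k = i at hki
      subst hki
      obtain ⟨v, -, hv⟩ := hcc
      change c' v < c v at hv
      have hvk : v ∈ f k := by
        by_contra hn
        rw [hc v hn] at hv
        exact (Fin.not_lt_zero _ hv).elim
      refine ⟨⟨v, c' v⟩, mem_expansionColon.2 (Or.inr ⟨hvk, hv⟩),
        mem_expansionFace.2 ⟨hvk, rfl⟩, ?_⟩
      rw [mem_expansionFace]
      exact fun hn => hv.ne hn.2

end Expansion

/-- if `Δ` is pure of dimension `d`, `I(Δ)` has linear quotients and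
`α = (s,…,s)`, then `pd(I(Δ^α)) = pd(I(Δ))·s + (d+1)(s-1)`. -/
theorem projDim_facetIdeal_expansion_eq (n : ℕ) (K : Type) [Field K]
    (Δ : Set (Finset (Fin n))) (hΔ : IsComplex Δ)
    (hpure : ∀ F G, IsFacet Δ F → IsFacet Δ G → F.card = G.card)
    (d : ℕ) (hd : IsGreatest {c : ℕ | ∃ F, IsFacet Δ F ∧ F.card = c} (d + 1))
    (s : ℕ) (hs : 1 ≤ s)
    (hlq : HasLinearQuotients K Δ) :
    projDim (MvPolynomial ((_ : Fin n) × Fin s) K)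
        (facetIdeal K (expansion Δ (fun _ => s)) : Ideal (MvPolynomial ((_ : Fin n) × Fin s) K)) =
      projDim (MvPolynomial (Fin n) K) (facetIdeal K Δ : Ideal (MvPolynomial (Fin n) K)) * (s : ℕ∞)
        + (((d + 1) * (s - 1) : ℕ) : ℕ∞) := by
  classical
  have : NeZero s := ⟨by omega⟩
  obtain ⟨m, f, T, hr, hT⟩ := hlq.exists_linearColon
  have hf (i : Fin m) : IsFacet Δ (f i) := hr.subset ⟨i, rfl⟩
  obtain ⟨F, hF, hFd⟩ := hd.1
  have hcard (i : Fin m) : (f i).card = d + 1 := (hpure _ _ (hf i) hF).trans hFd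
  obtain ⟨i₀, -⟩ : F ∈ Set.range f := hr.superset hF
  have : Nonempty (Fin m) := ⟨i₀⟩
  obtain ⟨i, hi⟩ := Finite.exists_max fun i => (T i).card
  have h₁ : projDim (MvPolynomial (Fin n) K)
      (facetIdeal K Δ : Ideal (MvPolynomial (Fin n) K)) = (T i).card := by
    have := projDim_sqfreeIdeal (K := K) f T Finset.univ
      (fun j _ k _ => (hcard j).trans (hcard k).symm) (fun j _ => by simpa using hT j)
      (fun j _ => hi j) ⟨i, Finset.mem_univ i, rfl⟩
    rwa [Finset.coe_univ, Set.image_univ, hr] at this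
  let A : Finset (Fin m ×ₗ Lex (Fin n → Fin s)) :=
    Finset.univ.filter fun x => ∀ v ∉ f (ofLex x).1, ofLex (ofLex x).2 v = 0
  have hA (x) : x ∈ A ↔ ∀ v ∉ f (ofLex x).1, ofLex (ofLex x).2 v = 0 := by
    rw [Finset.mem_filter]
    exact and_iff_right (Finset.mem_univ x)
  have himage : (fun y : Fin m ×ₗ Lex (Fin n → Fin s) =>
      expansionFace (f (ofLex y).1) (ofLex (ofLex y).2)) '' (A : Set _) =
      {G | IsFacet (expansion Δ fun _ => s) G} := by
    ext G
    rw [Set.mem_ofPred_eq, isFacet_expansion_iff]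
    constructor
    · rintro ⟨x, -, rfl⟩
      exact ⟨_, hf _, _, rfl⟩
    · rintro ⟨F, hF, c, rfl⟩
      obtain ⟨j, rfl⟩ := hr.superset hF
      refine ⟨toLex (j, toLex fun v => if v ∈ f j then c v else 0), (hA _).2 fun v hv => if_neg hv,
        ?_⟩
      ext x
      simp only [mem_expansionFace, ofLex_toLex]
      exact and_congr_right fun hx => by rw [if_pos hx]
  have h₂ := projDim_sqfreeIdeal (K := K) (p := (T i).card * s + (d + 1) * (s - 1)) _ _ A
    (fun x _ y _ => by rw [card_expansionFace, card_expansionFace, hcard, hcard])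
    (linearColon_expansion hT A hA) (fun x _ => by
      rw [card_expansionColon (hT _).disjoint, ← hcard (ofLex x).1]
      refine Nat.add_le_add (Nat.mul_le_mul_right s (hi _)) ?_
      rw [← smul_eq_mul]
      exact Finset.sum_le_card_nsmul _ _ _ fun v _ => by omega)
    ⟨toLex (i, toLex fun v => if v ∈ f i then ⟨s - 1, by omega⟩ else 0),
      (hA _).2 fun v hv => if_neg hv, by
        rw [card_expansionColon (hT _).disjoint, ← hcard i, ← smul_eq_mul (f i).card]
        congr 1
        refine Finset.sum_eq_card_nsmul fun v hv => ?_
        change ((if v ∈ f i then (⟨s - 1, by omega⟩ : Fin s) else 0 : Fin s) : ℕ) = s - 1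
        rw [if_pos (show v ∈ f i from hv)]⟩
  rw [himage] at h₂
  rw [h₁]
  refine h₂.trans ?_
  push_cast
  rfl
end

section
/- Let K be a field and G a simple graph on X = {x_1,…,x_n} with distinct vertices x, y ∈ V(G) such that N_G[x] = N_G[y]. If the quotient of K[x_1,…,x_n] by the edge ideal I(G) is Cohen-Macaulay, then the quotient of the polynomial ring on V(G) ∖ {x} by the edge ideal I(G ∖ x) of the induced subgraph G ∖ x is Cohen-Macaulay. -/
/-- The edge ideal `I(G) = (x_u x_v : {u,v} ∈ E(G))` of a simple graph; the quotient by it is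
the Stanley-Reisner ring of the independence complex of `G`. -/
noncomputable def edgeIdeal (K : Type*) [Field K] {V : Type*} (G : SimpleGraph V) :
    Ideal (MvPolynomial V K) :=
  Ideal.span {m | ∃ u v, G.Adj u v ∧ m = MvPolynomial.X u * MvPolynomial.X v}

/-- The depth of a local ring: the supremum of the lengths of the regular sequences
contained in the maximal ideal. -/
noncomputable def localRingDepth (R : Type*) [CommRing R] [IsLocalRing R] : ℕ∞ :=
  sSup {d : ℕ∞ | ∃ rs : List R, (rs.length : ℕ∞) = d ∧
    (∀ r ∈ rs, r ∈ IsLocalRing.maximalIdeal R) ∧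
    RingTheory.Sequence.IsRegular (R := R) R rs}

/-- A Cohen-Macaulay ring: a Noetherian ring such that the localization at every maximal
ideal has depth equal to its Krull dimension. -/
def IsCohenMacaulayRing (R : Type*) [CommRing R] : Prop :=
  IsNoetherianRing R ∧
    ∀ P : Ideal R, ∀ hP : P.IsMaximal,
      haveI : P.IsPrime := hP.isPrime
      WithBot.some (localRingDepth (Localization.AtPrime P)) =
        ringKrullDim (Localization.AtPrime P)

open IsLocalRing RingTheory.Sequence Pointwise

section RegularElements

/-- An element outside all associated primes is regular. -/
lemma isSMulRegular_of_forall_notMem_associatedPrimes {R M : Type*} [CommRing R]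
    [IsNoetherianRing R] [AddCommGroup M] [Module R M] {r : R}
    (hr : ∀ p ∈ associatedPrimes R M, r ∉ p) : IsSMulRegular M r := by
  rw [isSMulRegular_iff_right_eq_zero_of_smul]
  intro z hz
  by_contra h0
  have : r ∈ ⋃ p ∈ associatedPrimes R M, (p : Set R) := by
    rw [biUnion_associatedPrimes_eq_zero_divisors]
    exact ⟨z, h0, hz⟩
  simp only [Set.mem_iUnion] at this
  obtain ⟨p, hp, hrp⟩ := this
  exact hr p hp hrp

/-- A module without socle does not have the maximal ideal as an associated prime. -/
lemma maximalIdeal_notMem_associatedPrimes {R M : Type*} [CommRing R] [IsLocalRing R]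
    [IsNoetherianRing R] [AddCommGroup M] [Module R M]
    (hM : ∀ z : M, (∀ c ∈ maximalIdeal R, c • z = 0) → z = 0) :
    maximalIdeal R ∉ associatedPrimes R M := by
  intro h
  rw [AssociatedPrimes.mem_iff, isAssociatedPrime_iff] at h
  obtain ⟨hp, z, hz⟩ := h
  have h0 : z = 0 := hM z fun c hc ↦ by
    rw [hz, Submodule.mem_colon_singleton] at hc
    simpa using hc
  apply hp.ne_top
  rw [hz, h0, Ideal.eq_top_iff_one, Submodule.mem_colon_singleton]
  simp

variable {R : Type*} [CommRing R] [IsLocalRing R]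

/-- In the quotients of `M` by two regular elements of the maximal ideal, the socle vanishes
simultaneously. -/
lemma eq_zero_of_maximalIdeal_smul_eq_zero_of_quotSMulTop {M : Type*} [AddCommGroup M]
    [Module R M] {a b : R} (ha : IsSMulRegular M a) (hb : IsSMulRegular M b)
    (hbm : b ∈ maximalIdeal R)
    (h : ∀ z : QuotSMulTop b M, (∀ c ∈ maximalIdeal R, c • z = 0) → z = 0)
    (z : QuotSMulTop a M) (hz : ∀ c ∈ maximalIdeal R, c • z = 0) : z = 0 := by
  obtain ⟨z, rfl⟩ := Submodule.Quotient.mk_surjective _ z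
  have key : ∀ c ∈ maximalIdeal R, ∃ w : M, a • w = c • z := by
    intro c hc
    have h1 := hz c hc
    rw [← Submodule.Quotient.mk_smul, Submodule.Quotient.mk_eq_zero,
      Submodule.mem_smul_pointwise_iff_exists] at h1
    obtain ⟨w, -, hw⟩ := h1
    exact ⟨w, hw⟩
  obtain ⟨w, hw⟩ := key b hbm
  have h2 : (Submodule.Quotient.mk w : QuotSMulTop b M) = 0 := by
    apply h
    intro c hc
    obtain ⟨u, hu⟩ := key c hc
    rw [← Submodule.Quotient.mk_smul, Submodule.Quotient.mk_eq_zero,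
      Submodule.mem_smul_pointwise_iff_exists]
    refine ⟨u, trivial, ha ?_⟩
    change a • b • u = a • c • w
    rw [smul_comm a b u, hu, smul_comm a c w, hw, smul_comm]
  rw [Submodule.Quotient.mk_eq_zero, Submodule.mem_smul_pointwise_iff_exists] at h2
  obtain ⟨v, -, hv⟩ := h2
  rw [Submodule.Quotient.mk_eq_zero, Submodule.mem_smul_pointwise_iff_exists]
  refine ⟨v, trivial, hb ?_⟩
  change b • a • v = b • z
  rw [← hw, ← hv, smul_comm]

lemma IsSMulRegular.eq_zero_of_maximalIdeal_smul_eq_zero {M : Type*} [AddCommGroup M]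
    [Module R M] {r : R} (hr : IsSMulRegular M r) (hrm : r ∈ maximalIdeal R) (z : M)
    (hz : ∀ c ∈ maximalIdeal R, c • z = 0) : z = 0 :=
  hr.right_eq_zero_of_smul (hz r hrm)

variable [IsNoetherianRing R]

/-- Prime avoidance: two finite modules without socle have a common regular element in the
image of any ideal whose extension has the maximal ideal as its only prime over-ideal. -/
lemma exists_mem_isSMulRegular_map {A : Type*} [CommRing A] (f : A →+* R) (I : Ideal A)
    (hI : ∀ p : Ideal R, p.IsPrime → I.map f ≤ p → p = maximalIdeal R)
    (M N : Type*) [AddCommGroup M] [Module R M] [Module.Finite R M]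
    [AddCommGroup N] [Module R N] [Module.Finite R N]
    (hM : ∀ z : M, (∀ c ∈ maximalIdeal R, c • z = 0) → z = 0)
    (hN : ∀ z : N, (∀ c ∈ maximalIdeal R, c • z = 0) → z = 0) :
    ∃ a ∈ I, IsSMulRegular M (f a) ∧ IsSMulRegular N (f a) := by
  have prime : ∀ p ∈ associatedPrimes R M ∪ associatedPrimes R N, p.IsPrime := by
    rintro p (hp | hp)
    · exact hp.isPrime
    · exact hp.isPrime
  have avoid : ¬ (I : Set A) ⊆ ⋃ p ∈ associatedPrimes R M ∪ associatedPrimes R N,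
      (p.comap f : Ideal A) := by
    rw [Ideal.subset_union_prime_finite
      ((associatedPrimes.finite R M).union (associatedPrimes.finite R N)) ⊥ ⊥
      fun p hp _ _ ↦ have := prime p hp; Ideal.comap_isPrime f p]
    rintro ⟨p, hp, hIp⟩
    have := hI p (prime p hp) (Ideal.map_le_iff_le_comap.mpr hIp)
    subst this
    exact hp.elim (maximalIdeal_notMem_associatedPrimes hM)
      (maximalIdeal_notMem_associatedPrimes hN)
  obtain ⟨a, haI, ha⟩ := Set.not_subset.mp avoid
  simp only [Set.mem_iUnion, not_exists] at ha
  exact ⟨a, haI, isSMulRegular_of_forall_notMem_associatedPrimes fun p hp ↦ ha p (.inl hp),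
    isSMulRegular_of_forall_notMem_associatedPrimes fun p hp ↦ ha p (.inr hp)⟩

/-- Every regular element of the maximal ideal starts a regular sequence as long as any given
one. -/
lemma RingTheory.Sequence.IsRegular.exists_cons {M : Type*} [AddCommGroup M] [Module R M]
    [Module.Finite R M] {a : R} (ham : a ∈ maximalIdeal R) (ha : IsSMulRegular M a)
    {r : R} {rs : List R} (hrm : ∀ s ∈ r :: rs, s ∈ maximalIdeal R)
    (hrs : IsRegular M (r :: rs)) :
    ∃ ts : List R, ts.length = rs.length ∧ (∀ t ∈ ts, t ∈ maximalIdeal R) ∧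
      IsRegular M (a :: ts) := by
  induction hd : rs.length generalizing M a r rs with
  | zero =>
    have := hrs.nontrivial
    refine ⟨[], rfl, by simp, ?_⟩
    rw [isRegular_iff_isWeaklyRegular_of_subset_maximalIdeal (by simpa using ham)]
    exact (isWeaklyRegular_singleton_iff M a).mpr ha
  | succ d ih =>
    obtain _ | ⟨r', rs⟩ := rs
    · simp at hd
    obtain ⟨hr, hrs'⟩ := (isRegular_cons_iff M r _).mp hrs
    have hr' := ((isRegular_cons_iff _ r' _).mp hrs').1
    have hrm₀ : r ∈ maximalIdeal R := hrm r (by simp)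
    have soc := hr'.eq_zero_of_maximalIdeal_smul_eq_zero (hrm r' (by simp))
    obtain ⟨c, hcm, hcr, hca⟩ := exists_mem_isSMulRegular_map (RingHom.id R) (maximalIdeal R)
      (fun p hp h ↦ ((maximalIdeal.isMaximal R).eq_of_le hp.ne_top (by simpa using h)).symm)
      (QuotSMulTop r M) (QuotSMulTop a M) soc
      (eq_zero_of_maximalIdeal_smul_eq_zero_of_quotSMulTop ha hr hrm₀ soc)
    simp only [RingHom.id_apply] at hcr hca
    obtain ⟨us, hus, husm, hreg⟩ := ih hcm hcr
      (fun s hs ↦ hrm s (List.mem_cons_of_mem _ hs)) hrs' (by simpa using hd)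
    have hreg' : IsRegular (QuotSMulTop c M) (r :: us) :=
      ((isRegular_cons_iff M c _).mp
        (isRegular_of_perm (IsRegular.cons hr hreg) (List.Perm.swap c r us))).2
    have hac : IsWeaklyRegular M [c, a] :=
      isWeaklyRegular_of_perm_of_subset_maximalIdeal
        (IsWeaklyRegular.cons ha ((isWeaklyRegular_singleton_iff _ c).mpr hca))
        (List.Perm.swap c a []) (by simp [-mem_maximalIdeal, ham, hcm])
    rw [isWeaklyRegular_cons_iff, isWeaklyRegular_singleton_iff] at hac
    obtain ⟨vs, hvs, hvsm, hvreg⟩ := ih ham hac.2 (r := r) (rs := us)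
      (List.forall_mem_cons.mpr ⟨hrm₀, husm⟩) hreg' hus
    exact ⟨c :: vs, by simp [hvs], List.forall_mem_cons.mpr ⟨hcm, hvsm⟩,
      isRegular_of_perm (IsRegular.cons hac.1 hvreg) (List.Perm.swap a c vs)⟩

/-- A regular sequence can be moved into the image of the maximal ideal of `A` along a ring
homomorphism `A →+* R` for which the maximal ideal of `R` is the only prime over that of `A`. -/
lemma RingTheory.Sequence.IsRegular.exists_map {A : Type*} [CommRing A] [IsLocalRing A]
    (f : A →+* R) [IsLocalHom f]
    (hf : ∀ p : Ideal R, p.IsPrime → (maximalIdeal A).map f ≤ p → p = maximalIdeal R)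
    {M : Type*} [AddCommGroup M] [Module R M] [Module.Finite R M] {rs : List R}
    (hrm : ∀ r ∈ rs, r ∈ maximalIdeal R) (hrs : IsRegular M rs) :
    ∃ ts : List A, ts.length = rs.length ∧ (∀ t ∈ ts, t ∈ maximalIdeal A) ∧
      IsRegular M (ts.map f) := by
  induction hd : rs.length generalizing M rs with
  | zero =>
    have := hrs.nontrivial
    exact ⟨[], rfl, by simp, IsRegular.nil R M⟩
  | succ d ih =>
    obtain _ | ⟨r, rs⟩ := rs
    · simp at hd
    have soc := (((isRegular_cons_iff M r _).mp hrs).1).eq_zero_of_maximalIdeal_smul_eq_zero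
      (hrm r (by simp))
    obtain ⟨a, ham, ha, -⟩ := exists_mem_isSMulRegular_map f (maximalIdeal A) hf M M soc soc
    obtain ⟨us, hus, husm, hreg⟩ := hrs.exists_cons
      ((mem_maximalIdeal _).mpr fun h ↦ ham (isUnit_of_map_unit f a h)) ha hrm
    obtain ⟨ts, hts, htsm, htreg⟩ := ih husm ((isRegular_cons_iff M _ _).mp hreg).2
      (by simpa [hus] using hd)
    exact ⟨a :: ts, by simp [hts], List.forall_mem_cons.mpr ⟨ham, htsm⟩, IsRegular.cons ha htreg⟩

end RegularElements

/-- Weakly regular sequences descend to direct summands. -/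
lemma RingTheory.Sequence.IsWeaklyRegular.of_leftInverse {R M N : Type*} [CommRing R]
    [AddCommGroup M] [Module R M] [AddCommGroup N] [Module R N] (f : N →ₗ[R] M)
    (g : M →ₗ[R] N) (hgf : g ∘ₗ f = LinearMap.id) {rs : List R} (h : IsWeaklyRegular M rs) :
    IsWeaklyRegular N rs := by
  induction rs generalizing M N with
  | nil => exact .nil R N
  | cons r rs ih =>
    rw [isWeaklyRegular_cons_iff] at h ⊢
    refine ⟨h.1.of_injective f ?_, ih (QuotSMulTop.map r f) (QuotSMulTop.map r g) ?_ h.2⟩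
    · exact Function.LeftInverse.injective (g := g) fun z ↦ LinearMap.congr_fun hgf z
    · rw [← QuotSMulTop.map_comp, hgf, QuotSMulTop.map_id]

section Retract

/-- Depth does not drop when passing to a retract `A` of `B` such that the maximal ideal of `B`
is the only prime over that of `A`. -/
lemma localRingDepth_le_of_retract {A B : Type*} [CommRing A] [IsLocalRing A] [CommRing B]
    [IsLocalRing B] [IsNoetherianRing B] (f : A →+* B) [IsLocalHom f] (g : B →+* A)
    (hgf : g.comp f = RingHom.id A)
    (hf : ∀ p : Ideal B, p.IsPrime → (maximalIdeal A).map f ≤ p → p = maximalIdeal B) :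
    localRingDepth B ≤ localRingDepth A := by
  refine sSup_le_sSup ?_
  rintro _ ⟨rs, rfl, hrm, hrs⟩
  obtain ⟨ts, hts, htm, htreg⟩ := hrs.exists_map f hf hrm
  refine ⟨ts, by rw [hts], htm, ?_⟩
  rw [isRegular_iff_isWeaklyRegular_of_subset_maximalIdeal htm]
  let := f.toAlgebra
  have hw : IsWeaklyRegular B ts :=
    (isWeaklyRegular_map_algebraMap_iff (R := A) (S := B) B ts).mp htreg.toIsWeaklyRegular
  refine hw.of_leftInverse (Algebra.linearMap A B)
    { toFun := g, map_add' := map_add g, map_smul' := fun a b ↦ ?_ } ?_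
  · rw [Algebra.smul_def, map_mul]
    exact congrArg (· * g b) (RingHom.congr_fun hgf a)
  · ext
    exact RingHom.congr_fun hgf 1

lemma localRingDepth_le_ringKrullDim (A : Type*) [CommRing A] [IsLocalRing A]
    [IsNoetherianRing A] : WithBot.some (localRingDepth A) ≤ ringKrullDim A := by
  obtain ⟨d, hd⟩ : ∃ d : ℕ∞, ringKrullDim A = WithBot.some d :=
    ⟨_, (WithBot.coe_unbot _ ringKrullDim_ne_bot).symm⟩
  rw [hd, WithBot.coe_le_coe]
  refine sSup_le ?_
  rintro _ ⟨rs, rfl, -, hrs⟩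
  have hlen := ringKrullDim_add_length_eq_ringKrullDim_of_isRegular rs hrs
  have := hrs.quot_ofList_smul_nontrivial ⊤
  have : Nontrivial (A ⧸ Ideal.ofList rs) := by simpa using this
  have h0 : 0 ≤ ringKrullDim (A ⧸ Ideal.ofList rs) := ringKrullDim_nonneg_of_nontrivial
  have h1 : ((rs.length : ℕ∞) : WithBot ℕ∞) ≤ (d : WithBot ℕ∞) := by
    rw [← hd, ← hlen]
    exact le_add_of_nonneg_left h0
  exact WithBot.coe_le_coe.mp h1

/-- A retract `A` of a Cohen-Macaulay ring `B` is Cohen-Macaulay if, over every maximal ideal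
of `A`, the only prime of `B` below its pullback along the retraction is that pullback. -/
theorem IsCohenMacaulayRing.of_retract {A B : Type*} [CommRing A] [CommRing B] (f : A →+* B)
    (g : B →+* A) (hgf : g.comp f = RingHom.id A)
    (hf : ∀ P : Ideal A, P.IsMaximal → ∀ Q : Ideal B, Q.IsPrime → P.map f ≤ Q →
      Q ≤ P.comap g → Q = P.comap g)
    (hB : IsCohenMacaulayRing B) : IsCohenMacaulayRing A := by
  have hg : Function.Surjective g :=
    Function.LeftInverse.surjective (g := f) fun a ↦ RingHom.congr_fun hgf a
  have := hB.1
  have hA : IsNoetherianRing A := isNoetherianRing_of_surjective B A g hg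
  refine ⟨hA, fun P hP ↦ ?_⟩
  have := hP.isPrime
  have hQ : (P.comap g).IsMaximal := Ideal.comap_isMaximal_of_surjective g hg
  have hfP : P = (P.comap g).comap f := by rw [Ideal.comap_comap, hgf, Ideal.comap_id]
  let F := Localization.localRingHom P (P.comap g) f hfP
  let G := Localization.localRingHom (P.comap g) P g rfl
  have hGF : G.comp F = RingHom.id _ := by
    rw [← Localization.localRingHom_id, ← Localization.localRingHom_comp]
    congr
  have hG : Function.Surjective G :=
    Function.LeftInverse.surjective (g := F) fun a ↦ RingHom.congr_fun hGF a
  have : IsLocalHom F := Localization.isLocalHom_localRingHom _ _ _ _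
  have hdepth := localRingDepth_le_of_retract F G hGF fun p hp hle ↦ by
    have hcomap := hf P hP (p.comap (algebraMap B _)) (Ideal.comap_isPrime _ p) ?_ ?_
    · refine ((maximalIdeal.isMaximal _).eq_of_le hp.ne_top ?_).symm
      rw [← Localization.AtPrime.map_eq_maximalIdeal, Ideal.map_le_iff_le_comap, hcomap]
    · rw [Ideal.map_le_iff_le_comap]
      intro a ha
      change algebraMap B _ (f a) ∈ p
      rw [← Localization.localRingHom_to_map P (P.comap g) f hfP]
      refine hle (Ideal.mem_map_of_mem F ?_)
      rw [← Localization.AtPrime.map_eq_maximalIdeal]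
      exact Ideal.mem_map_of_mem _ ha
    · exact (Ideal.comap_mono (le_maximalIdeal hp.ne_top)).trans
        (Localization.AtPrime.under_maximalIdeal (I := P.comap g)).le
  refine le_antisymm (localRingDepth_le_ringKrullDim _) ?_
  calc ringKrullDim (Localization.AtPrime P)
      ≤ ringKrullDim (Localization.AtPrime (P.comap g)) := ringKrullDim_le_of_surjective G hG
    _ = WithBot.some (localRingDepth (Localization.AtPrime (P.comap g))) := (hB.2 _ hQ).symm
    _ ≤ _ := WithBot.coe_le_coe.mpr hdepth

end Retract

section EdgeIdeal

open MvPolynomial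

variable (K : Type*) [Field K] {V : Type*} (G : SimpleGraph V)

lemma edgeIdeal_mk_X_mul_X {u v : V} (h : G.Adj u v) :
    Ideal.Quotient.mk (edgeIdeal K G) (X u) * Ideal.Quotient.mk (edgeIdeal K G) (X v) = 0 := by
  rw [← map_mul, Ideal.Quotient.eq_zero_iff_mem]
  exact Ideal.subset_span ⟨u, v, h, rfl⟩

/-- A family of elements of a `K`-algebra whose products along edges vanish defines an algebra
homomorphism on the quotient by the edge ideal. -/
noncomputable def edgeIdealLift {S : Type*} [CommRing S] [Algebra K S] (s : V → S)
    (hs : ∀ u v, G.Adj u v → s u * s v = 0) : MvPolynomial V K ⧸ edgeIdeal K G →ₐ[K] S :=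
  Ideal.Quotient.liftₐ (edgeIdeal K G) (aeval s) fun p hp ↦ by
    have : edgeIdeal K G ≤ RingHom.ker (aeval s : MvPolynomial V K →ₐ[K] S) := by
      refine Ideal.span_le.mpr ?_
      rintro _ ⟨u, v, huv, rfl⟩
      simp [hs u v huv]
    exact this hp

@[simp]
lemma edgeIdealLift_mk_X {S : Type*} [CommRing S] [Algebra K S] (s : V → S)
    (hs : ∀ u v, G.Adj u v → s u * s v = 0) (v : V) :
    edgeIdealLift K G s hs (Ideal.Quotient.mk _ (X v)) = s v :=
  aeval_X s v

variable {K G} in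
lemma edgeIdeal_algHom_ext {S : Type*} [Semiring S] [Algebra K S]
    {f g : MvPolynomial V K ⧸ edgeIdeal K G →ₐ[K] S}
    (h : ∀ v, f (Ideal.Quotient.mk _ (X v)) = g (Ideal.Quotient.mk _ (X v))) : f = g :=
  Ideal.Quotient.algHom_ext _ (MvPolynomial.algHom_ext h)

/-- Deleting a vertex `x` with the same closed neighbourhood as another vertex `y` preserves
Cohen-Macaulayness. The quotient for `G ∖ x` is a retract of the one for `G`, embedded by
`y ↦ x + y` and with retraction `x ↦ 0`. -/
theorem IsCohenMacaulayRing.edgeIdeal_deleteVertex {x y : V} (hxy : x ≠ y)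
    (hN : ∀ v, (G.Adj x v ∨ v = x) ↔ (G.Adj y v ∨ v = y))
    (hG : IsCohenMacaulayRing (MvPolynomial V K ⧸ edgeIdeal K G)) :
    IsCohenMacaulayRing (MvPolynomial {v : V // v ≠ x} K ⧸
      edgeIdeal K (G.induce {v : V | v ≠ x})) := by
  classical
  let H : SimpleGraph {v : V // v ≠ x} := G.induce {v : V | v ≠ x}
  let ξ (v : V) : MvPolynomial V K ⧸ edgeIdeal K G := Ideal.Quotient.mk _ (X v)
  let η (v : {v : V // v ≠ x}) : MvPolynomial {v : V // v ≠ x} K ⧸ edgeIdeal K H :=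
    Ideal.Quotient.mk _ (X v)
  have hξ {u v : V} (h : G.Adj u v) : ξ u * ξ v = 0 := edgeIdeal_mk_X_mul_X K G h
  have hη {u v : {v : V // v ≠ x}} (h : H.Adj u v) : η u * η v = 0 :=
    edgeIdeal_mk_X_mul_X K H h
  have hadj : G.Adj x y := ((hN y).mpr (.inr rfl)).resolve_right hxy.symm
  have htwin {v : V} (hv : v ≠ x) (h : G.Adj y v) : G.Adj x v :=
    ((hN v).mpr (.inl h)).resolve_right hv
  let s (v : {v : V // v ≠ x}) := if (v : V) = y then ξ x + ξ y else ξ v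
  let t (v : V) := if h : v ≠ x then η ⟨v, h⟩ else 0
  have hs : ∀ u v, H.Adj u v → s u * s v = 0 := by
    rintro ⟨u, hu⟩ ⟨v, hv⟩ (huv : G.Adj u v)
    simp only [s]
    split_ifs with h1 h2 h2
    · exact absurd (h1.trans h2.symm) huv.ne
    · subst h1
      rw [add_mul, hξ (htwin hv huv), hξ huv, add_zero]
    · subst h2
      rw [mul_add, hξ (htwin hu huv.symm).symm, hξ huv, add_zero]
    · exact hξ huv
  have ht : ∀ u v, G.Adj u v → t u * t v = 0 := by
    intro u v huv
    simp only [t]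
    split_ifs with h1 h2
    · exact hη (show H.Adj ⟨u, h1⟩ ⟨v, h2⟩ from huv)
    all_goals simp
  let f := edgeIdealLift K H s hs
  let g := edgeIdealLift K G t ht
  have fη (v) : f (η v) = s v := edgeIdealLift_mk_X K H s hs v
  have gξ (v) : g (ξ v) = t v := edgeIdealLift_mk_X K G t ht v
  have tx : t x = 0 := by simp [t]
  have tne {v : V} (h : v ≠ x) : t v = η ⟨v, h⟩ := by simp [t, h]
  have hgf : g.comp f = AlgHom.id K _ := by
    refine edgeIdeal_algHom_ext fun v ↦ ?_
    change g (f (η v)) = η v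
    rw [fη]
    by_cases hv : (v : V) = y
    · obtain ⟨_, hv'⟩ := v
      obtain rfl : _ = y := hv
      simp [s, gξ, tx, tne hv']
    · simp [s, hv, gξ, tne v.2]
  have hfg (b) : b - f (g b) ∈ Ideal.span {ξ x} := by
    let π := Ideal.Quotient.mkₐ K (Ideal.span {ξ x})
    suffices h : π = π.comp (f.comp g) from Ideal.Quotient.eq.mp (AlgHom.congr_fun h b)
    refine edgeIdeal_algHom_ext fun v ↦ ?_
    change Ideal.Quotient.mk _ (ξ v) = Ideal.Quotient.mk _ (f (g (ξ v)))
    rw [Ideal.Quotient.mk_eq_mk_iff_sub_mem, gξ]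
    by_cases hvx : v = x
    · subst hvx
      simp [tx]
    · rw [tne hvx, fη]
      by_cases hvy : v = y
      · subst hvy
        simp [s]
      · simp [s, hvy]
  refine hG.of_retract f.toRingHom g.toRingHom
    (RingHom.ext fun a ↦ AlgHom.congr_fun hgf a) fun P hP Q hQ hPQ hQP ↦ ?_
  refine hQP.antisymm fun b hb ↦ ?_
  have hfP {a} (ha : a ∈ P) : f a ∈ Q := hPQ (Ideal.mem_map_of_mem _ ha)
  have hx : ξ x ∈ Q := by
    refine (hQ.mem_or_mem (x := ξ x) (y := ξ y) (by rw [hξ hadj]; exact Q.zero_mem)).elim id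
      fun hy ↦ ?_
    have hyP : η ⟨y, hxy.symm⟩ ∈ P := by
      rw [← tne, ← gξ]
      exact hQP hy
    have := hfP hyP
    rw [fη] at this
    simp only [s, if_true] at this
    exact (Ideal.add_mem_iff_left Q hy).mp this
  have hmem : b - f (g b) ∈ Q := (Ideal.span_singleton_le_iff_mem Q).mpr hx (hfg b)
  exact sub_add_cancel b (f (g b)) ▸ Q.add_mem hmem (hfP hb)

end EdgeIdeal

/-- if `G` is a Cohen-Macaulay graph with distinct vertices `x, y` such that
`N_G[x] = N_G[y]`, then the induced subgraph `G ∖ x` is Cohen-Macaulay. -/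
theorem cohenMacaulay_deleteVertex (n : ℕ) (K : Type*) [Field K]
    (G : SimpleGraph (Fin n)) (x y : Fin n) (hxy : x ≠ y)
    (hN : {v : Fin n | G.Adj x v ∨ v = x} = {v : Fin n | G.Adj y v ∨ v = y})
    (hG : IsCohenMacaulayRing (MvPolynomial (Fin n) K ⧸ edgeIdeal K G)) :
    IsCohenMacaulayRing (MvPolynomial {v : Fin n // v ≠ x} K ⧸
      edgeIdeal K (G.induce {v : Fin n | v ≠ x})) := by
  exact hG.edgeIdeal_deleteVertex K G hxy fun v ↦ Set.ext_iff.mp hN v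
end

section
/- Let Δ = ⟨F_1,…,F_s⟩ be a simplicial complex on X = {x_1,…,x_n}, K a field, and suppose x_1 ∈ F_i for i = 1,…,r and x_1 ∉ F_i for i = r+1,…,s. Let α = (2,1,1,…,1). Then in S^α = K[x_{11}, x_{12}, x_2, …, x_n], the ideal J_{Δ^α} = ⋂_{F ∈ 𝔉(Δ^α)} P_F equals the sum of the ideal generated by all squarefree monomials x_{i_1}⋯x_{i_t} ∈ J_Δ with all i_l ≠ 1 and the ideal generated by all monomials x_{11}x_{12}·x_{i_1}⋯x_{i_{t'}} such that x_1·x_{i_1}⋯x_{i_{t'}} ∈ J_Δ. -/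
/-- `P_F`, the ideal generated by the variables belonging to `F`. -/
noncomputable def varIdeal (K : Type*) [Field K] {V : Type*} (F : Finset V) :
    Ideal (MvPolynomial V K) :=
  Ideal.span (MvPolynomial.X '' (F : Set V))

/-- `J_Δ = ⋂_{F ∈ 𝔉(Δ)} P_F`, the Alexander dual of the facet ideal of `Δ`. -/
noncomputable def dualFacetIdeal (K : Type*) [Field K] {V : Type*} (Δ : Set (Finset V)) :
    Ideal (MvPolynomial V K) :=
  ⨅ F ∈ {F | IsFacet Δ F}, varIdeal K F

/-- The vector `α = (2,1,…,1)`: two copies of `x_1` (the vertex `0`), one copy of every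
other vertex. -/
def expVec (n : ℕ) [NeZero n] : Fin n → ℕ := fun j => if j = 0 then 2 else 1

/-- The first copy `x_{i1}` of a vertex `x_i` in `X^{(2,1,…,1)}`. -/
def copy1 {n : ℕ} [NeZero n] (i : Fin n) : (j : Fin n) × Fin (expVec n j) :=
  ⟨i, ⟨0, by unfold expVec; split <;> omega⟩⟩

/-- The second copy `x_{12}` of the vertex `x_1` in `X^{(2,1,…,1)}`. -/
def copy2 {n : ℕ} [NeZero n] : (j : Fin n) × Fin (expVec n j) :=
  ⟨0, ⟨1, by simp [expVec]⟩⟩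

open MvPolynomial in
theorem mem_varIdeal_iff {K V : Type*} [Field K] {F : Finset V} {f : MvPolynomial V K} :
    f ∈ varIdeal K F ↔ ∀ m ∈ f.support, ∃ v ∈ F, m v ≠ 0 := by
  simp [varIdeal, mem_ideal_span_X_image]

open MvPolynomial in
theorem prod_X_mem_varIdeal_iff {K V : Type*} [Field K] {F T : Finset V} :
    (∏ v ∈ T, X v : MvPolynomial V K) ∈ varIdeal K F ↔ ∃ v ∈ T, v ∈ F := by
  classical
  have h : (∏ v ∈ T, X v : MvPolynomial V K) = monomial (Finsupp.indicator T fun _ _ => 1) 1 := by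
    rw [monomial_eq, map_one, one_mul, Finsupp.prod_of_support_subset _
      (Finsupp.support_indicator_subset T _) _ (by simp)]
    exact Finset.prod_congr rfl fun v hv => by simp [Finsupp.indicator_of_mem hv]
  rw [h, mem_varIdeal_iff]
  simp [support_monomial, Finsupp.indicator_apply, and_comm]

theorem mem_dualFacetIdeal_iff {K V : Type*} [Field K] {Δ : Set (Finset V)}
    {f : MvPolynomial V K} :
    f ∈ dualFacetIdeal K Δ ↔ ∀ F, IsFacet Δ F → f ∈ varIdeal K F := by
  simp [dualFacetIdeal]

theorem exists_mem_support_of_mem_dualFacetIdeal {K V : Type*} [Field K] {Δ : Set (Finset V)}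
    {f : MvPolynomial V K} (hf : f ∈ dualFacetIdeal K Δ) {m : V →₀ ℕ} (hm : m ∈ f.support)
    {F : Finset V} (hF : IsFacet Δ F) : ∃ v ∈ F, v ∈ m.support := by
  simpa using mem_varIdeal_iff.1 (mem_dualFacetIdeal_iff.1 hf F hF) m hm

theorem prod_X_mem_dualFacetIdeal_iff {K V : Type*} [Field K] {Δ : Set (Finset V)}
    {T : Finset V} :
    (∏ v ∈ T, MvPolynomial.X v : MvPolynomial V K) ∈ dualFacetIdeal K Δ ↔
      ∀ F, IsFacet Δ F → ∃ v ∈ T, v ∈ F := by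
  simp [mem_dualFacetIdeal_iff, prod_X_mem_varIdeal_iff]

open MvPolynomial in
theorem prod_X_dvd_monomial {K V : Type*} [Field K] {m : V →₀ ℕ} {U : Finset V}
    (hU : U ⊆ m.support) (c : K) : (∏ v ∈ U, X v) ∣ monomial m c := by
  rw [monomial_eq]
  refine Dvd.dvd.mul_left ((Finset.prod_dvd_prod_of_subset _ _ _ hU).trans ?_) _
  exact Finset.prod_dvd_prod_of_dvd _ _ fun v hv => dvd_pow_self _ (Finsupp.mem_support_iff.1 hv)

theorem mem_expansion_iff {V : Type*} [DecidableEq V] {Δ : Set (Finset V)} (hΔ : IsComplex Δ)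
    {α : V → ℕ} {G : Finset ((v : V) × Fin (α v))} :
    G ∈ expansion Δ α ↔ G.image Sigma.fst ∈ Δ ∧
      Set.InjOn Sigma.fst (G : Set ((v : V) × Fin (α v))) := by
  simp only [expansion, simplexExpansion, Set.mem_iUnion, Set.mem_ofPred_eq, exists_prop]
  exact ⟨fun ⟨F, hF, hG, hinj⟩ => ⟨hΔ hF hG, hinj⟩, fun h => ⟨_, h.1, subset_rfl, h.2⟩⟩

theorem isFacet_expansion_iff_s19 {V : Type*} [DecidableEq V] {Δ : Set (Finset V)}
    (hΔ : IsComplex Δ) {α : V → ℕ} (hα : ∀ v, 0 < α v) {G : Finset ((v : V) × Fin (α v))} :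
    IsFacet (expansion Δ α) G ↔ IsFacet Δ (G.image Sigma.fst) ∧
      Set.InjOn Sigma.fst (G : Set ((v : V) × Fin (α v))) := by
  constructor
  · rintro ⟨hG, hmax⟩
    obtain ⟨hGΔ, hinj⟩ := (mem_expansion_iff hΔ).1 hG
    refine ⟨⟨hGΔ, fun H hH hGH => hGH.antisymm fun w hw => ?_⟩, hinj⟩
    by_contra hwG
    have hmem : insert ⟨w, ⟨0, hα w⟩⟩ G ∈ expansion Δ α := by
      refine (mem_expansion_iff hΔ).2 ⟨hΔ hH ?_, ?_⟩
      · rw [Finset.image_insert]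
        exact Finset.insert_subset hw hGH
      · rw [Finset.coe_insert, Set.injOn_insert]
        · refine ⟨hinj, fun h => hwG ?_⟩
          rwa [← Finset.coe_image, Finset.mem_coe] at h
        · exact fun h => hwG (Finset.mem_image_of_mem Sigma.fst h)
    refine hwG (Finset.mem_image_of_mem Sigma.fst (a := ⟨w, ⟨0, hα w⟩⟩) ?_)
    rw [hmax _ hmem (Finset.subset_insert _ _)]
    exact Finset.mem_insert_self _ _
  · rintro ⟨⟨hGΔ, hmax⟩, hinj⟩
    refine ⟨(mem_expansion_iff hΔ).2 ⟨hGΔ, hinj⟩, fun G' hG' hGG' => hGG'.antisymm fun p hp => ?_⟩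
    obtain ⟨hG'Δ, hinj'⟩ := (mem_expansion_iff hΔ).1 hG'
    have hp' := Finset.mem_image_of_mem Sigma.fst hp
    rw [← hmax _ hG'Δ (Finset.image_subset_image hGG')] at hp'
    obtain ⟨q, hq, hqp⟩ := Finset.mem_image.1 hp'
    rwa [← hinj' (hGG' hq) hp hqp]

theorem isFacet_expansion_image {V : Type*} [DecidableEq V] {Δ : Set (Finset V)}
    (hΔ : IsComplex Δ) {α : V → ℕ} (hα : ∀ v, 0 < α v) {F : Finset V} (hF : IsFacet Δ F)
    (σ : V → (v : V) × Fin (α v)) (hσ : ∀ v, (σ v).1 = v) :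
    IsFacet (expansion Δ α) (F.image σ) := by
  refine (isFacet_expansion_iff_s19 hΔ hα).2 ⟨?_, ?_⟩
  · rwa [Finset.image_image, show Sigma.fst ∘ σ = id from funext hσ, Finset.image_id]
  · rw [Finset.coe_image]
    rintro _ ⟨v, -, rfl⟩ _ ⟨w, -, rfl⟩ h
    rw [hσ, hσ] at h
    rw [h]

theorem expVec_pos {n : ℕ} [NeZero n] (v : Fin n) : 0 < expVec n v := by
  unfold expVec; split <;> omega

theorem eq_copy1 {n : ℕ} [NeZero n] {p : (j : Fin n) × Fin (expVec n j)} (hp : p.1 ≠ 0) :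
    p = copy1 p.1 := by
  obtain ⟨i, k, hk⟩ := p
  have : k = 0 := by simp only [expVec, if_neg hp] at hk; omega
  subst this
  rfl

theorem eq_copy1_or_eq_copy2 {n : ℕ} [NeZero n] {p : (j : Fin n) × Fin (expVec n j)}
    (hp : p.1 = 0) : p = copy1 0 ∨ p = copy2 := by
  obtain ⟨i, k, hk⟩ := p
  obtain rfl : i = 0 := hp
  have : k = 0 ∨ k = 1 := by simp only [expVec, if_true] at hk; omega
  rcases this with rfl | rfl
  · exact .inl rfl
  · exact .inr rfl

theorem copy1_injective {n : ℕ} [NeZero n] :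
    Function.Injective (copy1 : Fin n → (j : Fin n) × Fin (expVec n j)) :=
  fun _ _ h => congrArg Sigma.fst h

theorem copy1_ne_copy2 {n : ℕ} [NeZero n] (i : Fin n) : copy1 i ≠ copy2 := by
  intro h
  obtain rfl : i = 0 := congrArg Sigma.fst h
  simp [copy1, copy2] at h

theorem prod_X_copy1 {n : ℕ} [NeZero n] (K : Type*) [Field K] (T : Finset (Fin n)) :
    (∏ i ∈ T, MvPolynomial.X (copy1 i) :
      MvPolynomial ((j : Fin n) × Fin (expVec n j)) K) =
      ∏ p ∈ T.image copy1, MvPolynomial.X p :=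
  (Finset.prod_image copy1_injective.injOn).symm

theorem X_copy1_mul_X_copy2_mul_prod {n : ℕ} [NeZero n] (K : Type*) [Field K]
    {T : Finset (Fin n)} (hT : 0 ∉ T) :
    (MvPolynomial.X (copy1 (0 : Fin n)) * MvPolynomial.X copy2 *
      ∏ i ∈ T, MvPolynomial.X (copy1 i) :
      MvPolynomial ((j : Fin n) × Fin (expVec n j)) K) =
      ∏ p ∈ insert copy2 ((insert 0 T).image copy1), MvPolynomial.X p := by
  rw [Finset.prod_insert, ← prod_X_copy1, Finset.prod_insert hT]
  · ring
  · simp only [Finset.mem_image, not_exists, not_and]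
    exact fun i _ => copy1_ne_copy2 i


/-- for `Δ = ⟨F_1,…,F_s⟩` with `x_1 ∈ F_i` exactly for `i ≤ r`, and
`α = (2,1,…,1)`, the ideal `J_{Δ^α}` is the sum of the ideal generated by the squarefree
monomials of `J_Δ` not involving `x_1` (rewritten in the variables `x_{i1}`) and the ideal
generated by the monomials `x_{11} x_{12} x_{i_1 1} ⋯ x_{i_{t'} 1}` with
`x_1 x_{i_1} ⋯ x_{i_{t'}} ∈ J_Δ`. -/
theorem dualFacetIdeal_expansion_two_one (n : ℕ) [NeZero n] (K : Type*) [Field K]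
    (s : ℕ) (F : Fin s → Finset (Fin n))
    (Δ : Set (Finset (Fin n))) (hΔ : Δ = {G | ∃ i : Fin s, G ⊆ F i})
    (hfacets : {G | IsFacet Δ G} = Set.range F)
    (r : ℕ) (hr : ∀ i : Fin s, (0 : Fin n) ∈ F i ↔ i.val < r) :
    dualFacetIdeal K (expansion Δ (expVec n)) =
      Ideal.span {m : MvPolynomial ((j : Fin n) × Fin (expVec n j)) K |
        ∃ T : Finset (Fin n), (0 : Fin n) ∉ T ∧
          (∏ i ∈ T, MvPolynomial.X i) ∈ dualFacetIdeal K Δ ∧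
          m = ∏ i ∈ T, MvPolynomial.X (copy1 i)} +
      Ideal.span {m : MvPolynomial ((j : Fin n) × Fin (expVec n j)) K |
        ∃ T : Finset (Fin n), (0 : Fin n) ∉ T ∧
          (MvPolynomial.X (0 : Fin n) * ∏ i ∈ T, MvPolynomial.X i) ∈ dualFacetIdeal K Δ ∧
          m = MvPolynomial.X (copy1 (0 : Fin n)) * MvPolynomial.X copy2 *
            ∏ i ∈ T, MvPolynomial.X (copy1 i)} := by
  have hC : IsComplex Δ := by
    subst hΔ
    exact fun A B ⟨i, hi⟩ hBA => ⟨i, hBA.trans hi⟩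
  have hpos := expVec_pos (n := n)
  apply le_antisymm
  · intro f hf
    rw [← f.support_sum_monomial_coeff]
    refine Ideal.sum_mem _ fun m hm => ?_
    have key : ∀ σ : Fin n → (j : Fin n) × Fin (expVec n j), (∀ v, (σ v).1 = v) →
        ∀ G, IsFacet Δ G → ∃ v ∈ G, σ v ∈ m.support := fun σ hσ G hG => by
      obtain ⟨_, hp, hpm⟩ :=
        exists_mem_support_of_mem_dualFacetIdeal hf hm (isFacet_expansion_image hC hpos hG σ hσ)
      obtain ⟨v, hv, rfl⟩ := Finset.mem_image.1 hp
      exact ⟨v, hv, hpm⟩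
    let T : Finset (Fin n) := {i | i ≠ 0 ∧ copy1 i ∈ m.support}
    have hT : ∀ i, i ∈ T ↔ i ≠ 0 ∧ copy1 i ∈ m.support := fun i => by
      simp only [T, Finset.mem_filter_univ]
    have h0 : (0 : Fin n) ∉ T := by simp [hT]
    have hTm : T.image copy1 ⊆ m.support :=
      Finset.image_subset_iff.2 fun i hi => ((hT i).1 hi).2
    by_cases hboth : copy1 0 ∈ m.support ∧ copy2 ∈ m.support
    · refine Ideal.mem_sup_right (Ideal.mem_of_dvd _ (prod_X_dvd_monomial
        (U := insert copy2 ((insert 0 T).image copy1)) ?_ _)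
        (Ideal.subset_span ⟨T, h0, ?_, (X_copy1_mul_X_copy2_mul_prod K h0).symm⟩))
      · rw [Finset.image_insert]
        exact Finset.insert_subset hboth.2 (Finset.insert_subset hboth.1 hTm)
      · rw [← Finset.prod_insert h0, prod_X_mem_dualFacetIdeal_iff]
        intro G hG
        obtain ⟨v, hv, hvm⟩ := key copy1 (fun _ => rfl) G hG
        refine ⟨v, ?_, hv⟩
        rw [Finset.mem_insert, hT]
        tauto
    · obtain ⟨c, hc, hcm⟩ : ∃ c : (j : Fin n) × Fin (expVec n j), c.1 = 0 ∧ c ∉ m.support := by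
        by_cases h : copy1 0 ∈ m.support
        · exact ⟨copy2, rfl, fun h' => hboth ⟨h, h'⟩⟩
        · exact ⟨copy1 0, rfl, h⟩
      refine Ideal.mem_sup_left (Ideal.mem_of_dvd _ (prod_X_dvd_monomial hTm _)
        (Ideal.subset_span ⟨T, h0, ?_, (prod_X_copy1 K T).symm⟩))
      rw [prod_X_mem_dualFacetIdeal_iff]
      intro G hG
      obtain ⟨v, hv, hvm⟩ := key (Function.update copy1 0 c) (fun v => by
        rcases eq_or_ne v 0 with rfl | h
        · simpa using hc
        · rw [Function.update_of_ne h]; rfl) G hG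
      rcases eq_or_ne v 0 with rfl | h
      · rw [Function.update_self] at hvm
        exact absurd hvm hcm
      · rw [Function.update_of_ne h] at hvm
        exact ⟨v, (hT v).2 ⟨h, hvm⟩, hv⟩
  · refine sup_le (Ideal.span_le.2 ?_) (Ideal.span_le.2 ?_)
    · rintro _ ⟨T, h0, hT, rfl⟩
      rw [SetLike.mem_coe, prod_X_copy1, prod_X_mem_dualFacetIdeal_iff]
      intro G hG
      obtain ⟨v, hvT, hvG⟩ := prod_X_mem_dualFacetIdeal_iff.1 hT _
        ((isFacet_expansion_iff_s19 hC hpos).1 hG).1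
      obtain ⟨p, hp, rfl⟩ := Finset.mem_image.1 hvG
      refine ⟨p, ?_, hp⟩
      rw [eq_copy1 fun h => h0 (h ▸ hvT)]
      exact Finset.mem_image_of_mem _ hvT
    · rintro _ ⟨T, h0, hT, rfl⟩
      rw [← Finset.prod_insert h0] at hT
      rw [SetLike.mem_coe, X_copy1_mul_X_copy2_mul_prod K h0, prod_X_mem_dualFacetIdeal_iff]
      intro G hG
      obtain ⟨v, hvT, hvG⟩ := prod_X_mem_dualFacetIdeal_iff.1 hT _
        ((isFacet_expansion_iff_s19 hC hpos).1 hG).1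
      obtain ⟨p, hp, rfl⟩ := Finset.mem_image.1 hvG
      refine ⟨p, ?_, hp⟩
      rcases eq_or_ne p.1 0 with h | h
      · rcases eq_copy1_or_eq_copy2 h with rfl | rfl <;> simp
      · rw [eq_copy1 h]
        exact Finset.mem_insert_of_mem (Finset.mem_image_of_mem _ hvT)
end
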